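/- arXiv:2009.10677 — 12 statements merged into one kernel-verified Lean document; each statement's English description precedes it below -/
import Mathlib

section
/- Let p = 3/√21. For all real numbers F₂ and F₄ satisfying F₄ ≥ F₂², one has (1−p)·(3+3F₂)/4 + p·(15−6F₂−F₄)/16 ≤ 3(√21−4)/2. (In particular, a rounding scheme whose average performance on the 3-clauses is (3+3F₂)/4 and on the 5-clauses is (15−6F₂−F₄)/16 achieves value at most 3(√21−4)/2 ≈ 0.8739 on the mixture that puts weight 1−3/√21 on the 3-clauses and 3/√21 on the 5-clauses.) -/
/-- The arithmetic core of the UGC-hardness bound for MAX NAE-{3,5}-SAT: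
with `p = 3/√21`, for all reals `F₂, F₄` with `F₄ ≥ F₂²`,
`(1−p)·(3+3F₂)/4 + p·(15−6F₂−F₄)/16 ≤ 3(√21−4)/2`. -/
theorem nae35_mixture_bound (F2 F4 : ℝ) (h : F4 ≥ F2 ^ 2) :
    (1 - 3 / Real.sqrt 21) * ((3 + 3 * F2) / 4)
      + (3 / Real.sqrt 21) * ((15 - 6 * F2 - F4) / 16)
      ≤ 3 * (Real.sqrt 21 - 4) / 2 := by
  have hs : Real.sqrt 21 ^ 2 = 21 := Real.sq_sqrt (by norm_num)
  have hp : 3 / Real.sqrt 21 = Real.sqrt 21 / 7 := by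
    rw [div_eq_div_iff (by positivity) (by norm_num)]
    linarith
  rw [hp]
  set s := Real.sqrt 21
  have hgap : 3 * (s - 4) / 2
      - ((1 - s / 7) * ((3 + 3 * F2) / 4) + s / 7 * ((15 - 6 * F2 - F4) / 16))
      = s / 112 * ((F2 - (2 * s - 9)) ^ 2 + (F4 - F2 ^ 2)) := by
    linear_combination (-(s - 9 - F2) / 28) * hs
  have hnonneg : 0 ≤ s / 112 * ((F2 - (2 * s - 9)) ^ 2 + (F4 - F2 ^ 2)) :=
    mul_nonneg (by positivity) (add_nonneg (sq_nonneg _) (sub_nonneg.2 h))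
  linarith
end

section
/- Let n ≥ 4 and let X₁, …, X_n be random variables on a probability space, each taking values in {−1, 1}. Suppose there are real numbers a and b such that E[XᵢXⱼ] = a for all i ≠ j and E[XᵢXⱼX_kX_l] = b for all pairwise-distinct indices i, j, k, l. Then 3n² − 2n + n(n−1)(6n−8)·a + n(n−1)(n−2)(n−3)·b ≥ (n + n(n−1)·a)². Consequently b ≥ a² − O(1/n). -/
open MeasureTheory

section DistinctSums

variable {ι : Type*} [Fintype ι] [DecidableEq ι]

lemma sum_compl_singleton (f : ι → ℝ) (i : ι) :
    ∑ j ∈ ({i} : Finset ι)ᶜ, f j = ∑ j, f j - f i := by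
  have h := Finset.sum_add_sum_compl {i} f
  rw [Finset.sum_singleton] at h
  linarith

lemma sum_compl_pair (f : ι → ℝ) {i j : ι} (hij : i ≠ j) :
    ∑ k ∈ ({i, j} : Finset ι)ᶜ, f k = ∑ k, f k - f i - f j := by
  have h := Finset.sum_add_sum_compl {i, j} f
  rw [Finset.sum_pair hij] at h
  linarith

lemma sum_compl_triple (f : ι → ℝ) {i j k : ι} (hij : i ≠ j) (hik : i ≠ k) (hjk : j ≠ k) :
    ∑ l ∈ ({i, j, k} : Finset ι)ᶜ, f l = ∑ l, f l - f i - f j - f k := by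
  have h := Finset.sum_add_sum_compl {i, j, k} f
  rw [Finset.sum_insert (by simp [hij, hik]), Finset.sum_pair hjk] at h
  linarith

/-- The sum of `f i j` over ordered pairs of distinct indices. -/
def sumDistinctPairs (f : ι → ι → ℝ) : ℝ :=
  ∑ i, ∑ j ∈ ({i} : Finset ι)ᶜ, f i j

/-- The sum of `f i j k l` over ordered quadruples of distinct indices. -/
def sumDistinctQuadruples (f : ι → ι → ι → ι → ℝ) : ℝ :=
  ∑ i, ∑ j ∈ ({i} : Finset ι)ᶜ, ∑ k ∈ ({i, j} : Finset ι)ᶜ,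
    ∑ l ∈ ({i, j, k} : Finset ι)ᶜ, f i j k l

lemma sumDistinctPairs_eq_of_forall {f : ι → ι → ℝ} {a : ℝ} (h : ∀ i j, i ≠ j → f i j = a) :
    sumDistinctPairs f = Fintype.card ι * (Fintype.card ι - 1) * a := by
  have h1 (i : ι) : ∑ j ∈ ({i} : Finset ι)ᶜ, f i j = (Fintype.card ι - 1) * a := by
    rw [Finset.sum_congr rfl fun j hj => h i j (by simpa [eq_comm] using hj),
      sum_compl_singleton (fun _ => a)]
    simp
    ring
  simp only [sumDistinctPairs, h1]
  simp
  ring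

lemma sumDistinctQuadruples_eq_of_forall {f : ι → ι → ι → ι → ℝ} {b : ℝ}
    (h : ∀ i j k l, i ≠ j → i ≠ k → i ≠ l → j ≠ k → j ≠ l → k ≠ l → f i j k l = b) :
    sumDistinctQuadruples f = Fintype.card ι * (Fintype.card ι - 1) * (Fintype.card ι - 2) *
      (Fintype.card ι - 3) * b := by
  have h3 (i j k : ι) (hij : i ≠ j) (hik : i ≠ k) (hjk : j ≠ k) :
      ∑ l ∈ ({i, j, k} : Finset ι)ᶜ, f i j k l = (Fintype.card ι - 3) * b := by
    rw [Finset.sum_congr rfl fun l hl => ?_, sum_compl_triple (fun _ => b) hij hik hjk]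
    · simp
      ring
    · simp only [Finset.mem_compl, Finset.mem_insert, Finset.mem_singleton, not_or] at hl
      exact h i j k l hij hik (Ne.symm hl.1) hjk (Ne.symm hl.2.1) (Ne.symm hl.2.2)
  have h2 (i j : ι) (hij : i ≠ j) :
      ∑ k ∈ ({i, j} : Finset ι)ᶜ, ∑ l ∈ ({i, j, k} : Finset ι)ᶜ, f i j k l =
        (Fintype.card ι - 2) * ((Fintype.card ι - 3) * b) := by
    rw [Finset.sum_congr rfl fun k hk => ?_,
      sum_compl_pair (fun _ => (Fintype.card ι - 3) * b) hij]
    · simp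
      ring
    · simp only [Finset.mem_compl, Finset.mem_insert, Finset.mem_singleton, not_or] at hk
      exact h3 i j k hij (Ne.symm hk.1) (Ne.symm hk.2)
  have h1 := sumDistinctPairs_eq_of_forall h2
  rw [sumDistinctPairs] at h1
  rw [sumDistinctQuadruples, h1]
  ring

lemma sumDistinctPairs_mul_of_sq_eq_one {x : ι → ℝ} (hx : ∀ i, x i ^ 2 = 1) :
    sumDistinctPairs (fun i j => x i * x j) = (∑ i, x i) ^ 2 - Fintype.card ι := by
  have h1 (i : ι) : ∑ j ∈ ({i} : Finset ι)ᶜ, x i * x j = (∑ j, x j) * x i - 1 := by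
    rw [← Finset.mul_sum, sum_compl_singleton]
    linear_combination -hx i
  simp only [sumDistinctPairs, h1, Finset.sum_sub_distrib, ← Finset.mul_sum]
  simp
  ring

lemma sumDistinctQuadruples_mul_of_sq_eq_one {x : ι → ℝ} (hx : ∀ i, x i ^ 2 = 1) :
    sumDistinctQuadruples (fun i j k l => x i * x j * x k * x l) =
      (∑ i, x i) ^ 4 - (6 * Fintype.card ι - 8) * (∑ i, x i) ^ 2 +
        3 * (Fintype.card ι : ℝ) ^ 2 - 6 * Fintype.card ι := by
  set S := ∑ i, x i with hS
  set n := (Fintype.card ι : ℝ) with hn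
  have h3 (i j k : ι) (hij : i ≠ j) (hik : i ≠ k) (hjk : j ≠ k) :
      ∑ l ∈ ({i, j, k} : Finset ι)ᶜ, x i * x j * x k * x l =
        (x i * x j * S - x i - x j) * x k - x i * x j := by
    rw [← Finset.mul_sum, sum_compl_triple x hij hik hjk]
    linear_combination -(x j * x k) * hx i - x i * x k * hx j - x i * x j * hx k
  have h2 (i j : ι) (hij : i ≠ j) :
      ∑ k ∈ ({i, j} : Finset ι)ᶜ, ∑ l ∈ ({i, j, k} : Finset ι)ᶜ, x i * x j * x k * x l =
        (x i * S ^ 2 - 2 * S - (n - 4) * x i) * x j + (2 - 2 * S * x i) := by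
    rw [Finset.sum_congr rfl fun k hk => ?_,
      sum_compl_pair (fun k => (x i * x j * S - x i - x j) * x k - x i * x j) hij]
    · rw [Finset.sum_sub_distrib, ← Finset.mul_sum, ← hS, Finset.sum_const, Finset.card_univ,
        nsmul_eq_mul, ← hn]
      linear_combination (1 - x j * S) * hx i + (1 - x i * S) * hx j
    · simp only [Finset.mem_compl, Finset.mem_insert, Finset.mem_singleton, not_or] at hk
      exact h3 i j k hij (Ne.symm hk.1) (Ne.symm hk.2)
  have h1 (i : ι) :
      ∑ j ∈ ({i} : Finset ι)ᶜ, ∑ k ∈ ({i, j} : Finset ι)ᶜ,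
        ∑ l ∈ ({i, j, k} : Finset ι)ᶜ, x i * x j * x k * x l =
        (S ^ 3 - (3 * n - 8) * S) * x i + (3 * n - 6 - 3 * S ^ 2) := by
    rw [Finset.sum_congr rfl fun j hj => h2 i j (by simpa [eq_comm] using hj),
      sum_compl_singleton
        (fun j => (x i * S ^ 2 - 2 * S - (n - 4) * x i) * x j + (2 - 2 * S * x i)),
      Finset.sum_add_distrib, ← Finset.mul_sum, ← hS, Finset.sum_const, Finset.card_univ,
      nsmul_eq_mul, ← hn]
    linear_combination (n - 4 - S ^ 2) * hx i
  simp only [sumDistinctQuadruples, h1]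
  rw [Finset.sum_add_distrib, ← Finset.mul_sum, ← hS, Finset.sum_const, Finset.card_univ,
    nsmul_eq_mul, ← hn]
  ring

variable {Ω : Type*} [MeasurableSpace Ω] {μ : Measure Ω}

lemma integral_sumDistinctPairs {f : ι → ι → Ω → ℝ} (hf : ∀ i j, Integrable (f i j) μ) :
    ∫ ω, sumDistinctPairs (fun i j => f i j ω) ∂μ =
      sumDistinctPairs (fun i j => ∫ ω, f i j ω ∂μ) := by
  unfold sumDistinctPairs
  rw [integral_finsetSum _ fun i _ => integrable_finsetSum _ fun j _ => hf i j]
  exact Finset.sum_congr rfl fun i _ => integral_finsetSum _ fun j _ => hf i j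

lemma integral_sumDistinctQuadruples {f : ι → ι → ι → ι → Ω → ℝ}
    (hf : ∀ i j k l, Integrable (f i j k l) μ) :
    ∫ ω, sumDistinctQuadruples (fun i j k l => f i j k l ω) ∂μ =
      sumDistinctQuadruples (fun i j k l => ∫ ω, f i j k l ω ∂μ) := by
  have h3 (i j k : ι) (s : Finset ι) : Integrable (fun ω => ∑ l ∈ s, f i j k l ω) μ :=
    integrable_finsetSum _ fun l _ => hf i j k l
  have h2 (i j : ι) : Integrable (fun ω => ∑ k ∈ ({i, j} : Finset ι)ᶜ,
      ∑ l ∈ ({i, j, k} : Finset ι)ᶜ, f i j k l ω) μ :=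
    integrable_finsetSum _ fun k _ => h3 i j k _
  refine (integral_sumDistinctPairs h2).trans ?_
  refine Finset.sum_congr rfl fun i _ => Finset.sum_congr rfl fun j _ => ?_
  refine (integral_finsetSum _ fun k _ => h3 i j k _).trans ?_
  exact Finset.sum_congr rfl fun k _ => integral_finsetSum _ fun l _ => hf i j k l

end DistinctSums

/-- For `n ≥ 4` and ±1-valued random variables `X₁,…,Xₙ` with common pairwise
moment `a` and common fourth moment `b` (over pairwise-distinct indices),
`3n² − 2n + n(n−1)(6n−8)a + n(n−1)(n−2)(n−3)b ≥ (n + n(n−1)a)²`. -/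
theorem fourth_moment_inequality (n : ℕ) (hn : 4 ≤ n)
    (Ω : Type*) [MeasureSpace Ω] [IsProbabilityMeasure (volume : Measure Ω)]
    (X : Fin n → Ω → ℝ)
    (hXval : ∀ i ω, X i ω = 1 ∨ X i ω = -1)
    (hXmeas : ∀ i, Measurable (X i))
    (a b : ℝ)
    (ha : ∀ i j, i ≠ j → (∫ ω, X i ω * X j ω) = a)
    (hb : ∀ i j k l, i ≠ j → i ≠ k → i ≠ l → j ≠ k → j ≠ l → k ≠ l →
      (∫ ω, X i ω * X j ω * X k ω * X l ω) = b) :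
    3 * (n : ℝ) ^ 2 - 2 * n + n * (n - 1) * (6 * n - 8) * a
        + n * (n - 1) * (n - 2) * (n - 3) * b
      ≥ ((n : ℝ) + n * (n - 1) * a) ^ 2 := by
  have hsq (ω : Ω) (i : Fin n) : X i ω ^ 2 = 1 := by
    rcases hXval i ω with h | h <;> simp [h]
  have habs (i : Fin n) (ω : Ω) : |X i ω| = 1 := by
    rcases hXval i ω with h | h <;> simp [h]
  have hint2 (i j : Fin n) : Integrable (fun ω => X i ω * X j ω) :=
    Integrable.of_bound (by fun_prop) 1 (.of_forall fun ω => by simp [habs])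
  have hint4 (i j k l : Fin n) : Integrable (fun ω => X i ω * X j ω * X k ω * X l ω) :=
    Integrable.of_bound (by fun_prop) 1 (.of_forall fun ω => by simp [habs])
  set S : Ω → ℝ := fun ω => ∑ i, X i ω with hS
  have hSbound (ω : Ω) : |S ω| ≤ n :=
    (Finset.abs_sum_le_sum_abs _ _).trans (by simp [habs])
  have hT : MemLp (fun ω => S ω ^ 2) 2 :=
    MemLp.of_bound (by fun_prop) ((n : ℝ) ^ 2) (.of_forall fun ω => by
      rw [Real.norm_eq_abs, abs_pow]
      gcongr
      exact hSbound ω)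
  have hT1 : Integrable (fun ω => S ω ^ 2) := hT.integrable one_le_two
  have hT2 : Integrable (fun ω => S ω ^ 4) := by
    simpa [← pow_mul] using hT.integrable_sq
  have hvar : (∫ ω, S ω ^ 2) ^ 2 ≤ ∫ ω, S ω ^ 4 := by
    have h := ProbabilityTheory.variance_nonneg (fun ω => S ω ^ 2) volume
    rw [ProbabilityTheory.variance_eq_sub hT] at h
    simpa [← pow_mul] using h
  have hpairs : (∫ ω, S ω ^ 2) - n = n * (n - 1) * a := by
    have h := integral_sumDistinctPairs hint2
    simp only [sumDistinctPairs_mul_of_sq_eq_one (hsq _), sumDistinctPairs_eq_of_forall ha,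
      Fintype.card_fin] at h
    rw [integral_sub hT1 (integrable_const _)] at h
    simpa using h
  have hquads : (∫ ω, S ω ^ 4) - (6 * n - 8) * (∫ ω, S ω ^ 2) + 3 * (n : ℝ) ^ 2 - 6 * n =
      n * (n - 1) * (n - 2) * (n - 3) * b := by
    have h := integral_sumDistinctQuadruples hint4
    simp only [sumDistinctQuadruples_mul_of_sq_eq_one (hsq _),
      sumDistinctQuadruples_eq_of_forall hb, Fintype.card_fin] at h
    have hdiff : Integrable (fun ω => S ω ^ 4 - (6 * (n : ℝ) - 8) * S ω ^ 2) :=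
      hT2.sub (hT1.const_mul _)
    have hadd : Integrable
        (fun ω => S ω ^ 4 - (6 * (n : ℝ) - 8) * S ω ^ 2 + 3 * (n : ℝ) ^ 2) :=
      hdiff.add (integrable_const _)
    rw [integral_sub hadd (integrable_const _), integral_add hdiff (integrable_const _),
      integral_sub hT2 (hT1.const_mul _), integral_const_mul] at h
    simpa using h
  have hm : ∫ ω, S ω ^ 2 = n + n * (n - 1) * a := by linarith
  rw [hm] at hvar hquads
  linarith
end

section
/- Let F : [−1,1] → ℝ be an odd function (F(−x) = −F(x)) that is convex on [0,1]. Then for all x, x′ ∈ [−1,1] with −x ≥ |x′|, one has 2·F((x + x′)/2) ≥ F(x) + F(x′). -/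
/-- A convex function on `[0,1]` with nonpositive value at `0` is superadditive. -/
theorem ConvexOn.add_le_map_add_of_map_zero_nonpos {F : ℝ → ℝ}
    (hconv : ConvexOn ℝ (Set.Icc (0 : ℝ) 1) F) (hF : F 0 ≤ 0) {u v : ℝ}
    (hu : 0 ≤ u) (hv : 0 ≤ v) (huv : u + v ≤ 1) : F u + F v ≤ F (u + v) := by
  rcases (add_nonneg hu hv).eq_or_lt with hs | hs
  · obtain rfl : u = 0 := by linarith
    obtain rfl : v = 0 := by linarith
    simpa using hF
  · have hsum : u / (u + v) + v / (u + v) = 1 := by field_simp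
    have hu' : 0 ≤ u / (u + v) := by positivity
    have hv' : 0 ≤ v / (u + v) := by positivity
    have hmem : u + v ∈ Set.Icc (0 : ℝ) 1 := ⟨hs.le, huv⟩
    have hzero : (0 : ℝ) ∈ Set.Icc (0 : ℝ) 1 := by simp
    have h₁ := hconv.2 hmem hzero hu' hv' hsum
    have h₂ := hconv.2 hmem hzero hv' hu' (by rw [add_comm, hsum])
    simp only [smul_eq_mul, mul_zero, add_zero, div_mul_cancel₀ _ hs.ne'] at h₁ h₂
    calc
      F u + F v ≤ (u / (u + v) + v / (u + v)) * (F (u + v) + F 0) := by linarith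
      _ ≤ F (u + v) := by rw [hsum]; linarith


/-- First part of the key modifying lemma: if `F : [−1,1] → ℝ` is odd and
convex on `[0,1]`, then for all `x, x′ ∈ [−1,1]` with `−x ≥ |x′|`,
`2·F((x+x′)/2) ≥ F(x) + F(x′)`. -/
theorem key_modifying_lemma_one (F : ℝ → ℝ)
    (hodd : ∀ x ∈ Set.Icc (-1 : ℝ) 1, F (-x) = -F x)
    (hconv : ConvexOn ℝ (Set.Icc (0 : ℝ) 1) F)
    (x x' : ℝ) (hx : x ∈ Set.Icc (-1 : ℝ) 1) (hx' : x' ∈ Set.Icc (-1 : ℝ) 1)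
    (h : -x ≥ |x'|) :
    2 * F ((x + x') / 2) ≥ F x + F x' := by
  obtain ⟨h₁, h₂⟩ := abs_le.mp h
  obtain ⟨hx₁, hx₂⟩ := hx
  have hFx := hodd x ⟨hx₁, hx₂⟩
  have hFm := hodd ((x + x') / 2) ⟨by linarith, by linarith⟩
  rcases le_total x' 0 with hneg | hpos
  · have hFx' := hodd x' hx'
    have hmid := hconv.2 (x := -x) (y := -x') ⟨by linarith, by linarith⟩
      ⟨by linarith, by linarith⟩ (by norm_num : (0 : ℝ) ≤ 1 / 2)
      (by norm_num : (0 : ℝ) ≤ 1 / 2) (by norm_num)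
    simp only [smul_eq_mul] at hmid
    rw [show 1 / 2 * -x + 1 / 2 * -x' = -((x + x') / 2) by ring] at hmid
    linarith
  · have hF : F 0 ≤ 0 := by
      have h₀ := hodd 0 (by simp)
      rw [neg_zero] at h₀
      linarith
    have hadd := hconv.add_le_map_add_of_map_zero_nonpos hF
      (u := x') (v := -(x + x')) hpos (by linarith) (by linarith)
    have hdbl := hconv.add_le_map_add_of_map_zero_nonpos hF
      (u := -((x + x') / 2)) (v := -((x + x') / 2)) (by linarith) (by linarith) (by linarith)
    rw [show x' + -(x + x') = -x by ring] at hadd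
    rw [show -((x + x') / 2) + -((x + x') / 2) = -(x + x') by ring] at hdbl
    linarith
end

section
/- Let F : [−1,1] → ℝ be an odd function that is convex on [0,1]. Then for all x, x′ ∈ [−1,1] with x ≥ |x′| and all y ≥ 0 such that x + y ≤ 1 and x′ − y ≥ −1, one has F(x + y) + F(x′ − y) ≥ F(x) + F(x′). -/
/-- The increments of a convex function over a step of fixed length are nondecreasing. -/
theorem ConvexOn.add_le_add_of_step {s : Set ℝ} {F : ℝ → ℝ} (hF : ConvexOn ℝ s F) {a b y : ℝ}
    (hb : b ∈ s) (hay : a + y ∈ s) (hba : b ≤ a) (hy : 0 ≤ y) :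
    F a + F (b + y) ≤ F (a + y) + F b := by
  rcases (show 0 ≤ a + y - b by linarith).eq_or_lt with hD | hD
  · obtain rfl : y = 0 := by linarith
    simp
  · have hsum : y / (a + y - b) + (a - b) / (a + y - b) = 1 := by
      field_simp
      ring
    have hu : 0 ≤ y / (a + y - b) := by positivity
    have hv : 0 ≤ (a - b) / (a + y - b) := div_nonneg (by linarith) hD.le
    have h₁ := hF.2 hb hay hu hv hsum
    have h₂ := hF.2 hay hb hu hv hsum
    have e₁ : y / (a + y - b) * b + (a - b) / (a + y - b) * (a + y) = a := by
      field_simp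
      ring
    have e₂ : y / (a + y - b) * (a + y) + (a - b) / (a + y - b) * b = b + y := by
      field_simp
      ring
    simp only [smul_eq_mul, e₁, e₂] at h₁ h₂
    linear_combination h₁ + h₂ + (F (a + y) + F b) * hsum

/-- Second part of the key modifying lemma: if `F : [−1,1] → ℝ` is odd and
convex on `[0,1]`, then for all `x, x′ ∈ [−1,1]` with `x ≥ |x′|` and all
`y ≥ 0` with `x + y ≤ 1` and `x′ − y ≥ −1`,
`F(x+y) + F(x′−y) ≥ F(x) + F(x′)`. -/
theorem key_modifying_lemma_two (F : ℝ → ℝ)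
    (hodd : ∀ x ∈ Set.Icc (-1 : ℝ) 1, F (-x) = -F x)
    (hconv : ConvexOn ℝ (Set.Icc (0 : ℝ) 1) F)
    (x x' y : ℝ) (hx : x ∈ Set.Icc (-1 : ℝ) 1) (hx' : x' ∈ Set.Icc (-1 : ℝ) 1)
    (h : x ≥ |x'|) (hy : 0 ≤ y) (hxy : x + y ≤ 1) (hx'y : x' - y ≥ -1) :
    F (x + y) + F (x' - y) ≥ F x + F x' := by
  obtain ⟨h₁, h₂⟩ := abs_le.mp h
  have step {a b t : ℝ} (hb : 0 ≤ b) (hba : b ≤ a) (ht : 0 ≤ t) (hat : a + t ≤ 1) :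
      F a + F (b + t) ≤ F (a + t) + F b :=
    hconv.add_le_add_of_step ⟨hb, by linarith⟩ ⟨by linarith, hat⟩ hba ht
  rcases le_total y x' with hc | hc
  · have := step (a := x) (b := x' - y) (t := y) (by linarith) (by linarith) hy hxy
    rw [sub_add_cancel] at this
    linarith
  rcases le_total x' 0 with hn | hp
  · have := step (a := x) (b := -x') (t := y) (by linarith) (by linarith) hy hxy
    have e := hodd (x' - y) ⟨hx'y, by linarith [hx'.2]⟩
    rw [hodd x' hx', show -x' + y = -(x' - y) by ring, e] at this
    linarith
  · have h0 : F 0 = 0 := by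
      have := hodd 0 (by norm_num)
      rw [neg_zero] at this
      linarith
    have i₁ := step (a := x + x') (b := 0) (t := y - x') le_rfl (by linarith) (by linarith)
      (by linarith)
    have i₂ := step (a := x) (b := 0) (t := x') le_rfl (by linarith) hp (by linarith)
    have e := hodd (x' - y) ⟨hx'y, by linarith⟩
    rw [neg_sub] at e
    rw [show x + x' + (y - x') = x + y by ring, zero_add, e] at i₁
    rw [zero_add] at i₂
    linarith
end

section
/- For real numbers b₁₂, b₁₃, b₂₃, the following are equivalent: (i) there exists a probability distribution on {−1,1}³ whose coordinate random variables X₁, X₂, X₃ satisfy E[X₁X₂] = b₁₂, E[X₁X₃] = b₁₃, E[X₂X₃] = b₂₃; (ii) b₁₂ + b₁₃ + b₂₃ ≥ −1, b₁₂ ≥ b₁₃ + b₂₃ − 1, b₁₃ ≥ b₁₂ + b₂₃ − 1, and b₂₃ ≥ b₁₂ + b₁₃ − 1. Equivalently, the polytope of possible pairwise biases of three ±1-valued random variables is the convex hull of (1,1,1), (1,−1,−1), (−1,1,−1), (−1,−1,1). -/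
/-- The ±1 value associated to a Boolean. -/
def pm (b : Bool) : ℝ := if b then 1 else -1

theorem pm_eq_one_or_neg_one (b : Bool) : pm b = 1 ∨ pm b = -1 := by
  cases b <;> simp [pm]

/-- A sum over Boolean triples is an iterated sum over the coordinates. -/
theorem sum_fin_three_bool (f : (Fin 3 → Bool) → ℝ) :
    ∑ s, f s = ∑ a, ∑ b, ∑ c, f ![a, b, c] := by
  simp only [← Fintype.sum_prod_type']
  refine (Fintype.sum_bijective (fun x : (Bool × Bool) × Bool ↦ ![x.1.1, x.1.2, x.2]) ?_ _ _
    fun _ ↦ rfl).symm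
  decide

/-- Characterization of the polytope of possible pairwise biases of three
±1-valued random variables: reals `b₁₂, b₁₃, b₂₃` arise as the pairwise
biases of some probability distribution on `{−1,1}³` if and only if
`b₁₂ + b₁₃ + b₂₃ ≥ −1`, `b₁₂ ≥ b₁₃ + b₂₃ − 1`, `b₁₃ ≥ b₁₂ + b₂₃ − 1` and
`b₂₃ ≥ b₁₂ + b₁₃ − 1`. -/
theorem pairwise_bias_polytope (b12 b13 b23 : ℝ) :
    (∃ p : (Fin 3 → Bool) → ℝ, (∀ s, 0 ≤ p s) ∧ (∑ s, p s) = 1 ∧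
      (∑ s, p s * (pm (s 0) * pm (s 1))) = b12 ∧
      (∑ s, p s * (pm (s 0) * pm (s 2))) = b13 ∧
      (∑ s, p s * (pm (s 1) * pm (s 2))) = b23) ↔
    (b12 + b13 + b23 ≥ -1 ∧ b12 ≥ b13 + b23 - 1 ∧
      b13 ≥ b12 + b23 - 1 ∧ b23 ≥ b12 + b13 - 1) := by
  constructor
  · rintro ⟨p, hp, h1, rfl, rfl, rfl⟩
    have key (e12 e13 e23 : ℝ) (h : ∀ s : Fin 3 → Bool,
        0 ≤ 1 + e12 * (pm (s 0) * pm (s 1)) + e13 * (pm (s 0) * pm (s 2)) +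
          e23 * (pm (s 1) * pm (s 2))) :
        0 ≤ 1 + e12 * (∑ s, p s * (pm (s 0) * pm (s 1))) +
          e13 * (∑ s, p s * (pm (s 0) * pm (s 2))) +
          e23 * (∑ s, p s * (pm (s 1) * pm (s 2))) := by
      rw [← h1]
      simp only [Finset.mul_sum, ← Finset.sum_add_distrib]
      refine Finset.sum_nonneg fun s _ ↦ (mul_nonneg (hp s) (h s)).trans_eq ?_
      ring
    have signs (e12 e13 e23 : ℝ) (h : 0 ≤ 1 + e12 + e13 + e23 ∧ 0 ≤ 1 + e12 - e13 - e23 ∧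
        0 ≤ 1 - e12 + e13 - e23 ∧ 0 ≤ 1 - e12 - e13 + e23) :=
      key e12 e13 e23 fun s ↦ by
        rcases pm_eq_one_or_neg_one (s 0) with h0 | h0 <;>
        rcases pm_eq_one_or_neg_one (s 1) with h1 | h1 <;>
        rcases pm_eq_one_or_neg_one (s 2) with h2 | h2 <;>
        rw [h0, h1, h2] <;> linarith
    have i0 := signs 1 1 1 (by norm_num)
    have i1 := signs 1 (-1) (-1) (by norm_num)
    have i2 := signs (-1) 1 (-1) (by norm_num)
    have i3 := signs (-1) (-1) 1 (by norm_num)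
    refine ⟨?_, ?_, ?_, ?_⟩ <;> linarith
  · rintro ⟨i0, i1, i2, i3⟩
    refine ⟨fun s ↦ (1 + b12 * (pm (s 0) * pm (s 1)) + b13 * (pm (s 0) * pm (s 2)) +
      b23 * (pm (s 1) * pm (s 2))) / 8, fun s ↦ ?_, ?_, ?_, ?_, ?_⟩
    · rcases pm_eq_one_or_neg_one (s 0) with h0 | h0 <;>
      rcases pm_eq_one_or_neg_one (s 1) with h1 | h1 <;>
      rcases pm_eq_one_or_neg_one (s 2) with h2 | h2 <;>
      simp only [h0, h1, h2] <;> linarith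
    all_goals
      rw [sum_fin_three_bool]
      simp [pm]
      ring
end

section
/- Let F : [−1,1] → ℝ be an odd function that is convex on [0,1]. (i) If x ∈ [−1/3, 0], x′ ∈ [−1, 0], and (3x + 2x′)/5 ≥ −1/3, then 5·F((3x + 2x′)/5) ≥ 3·F(x) + 2·F(x′). (ii) If x ∈ [−1/3, 0], x′ ∈ [−1, −1/3], and (3x + 2x′)/5 ≤ −1/3, then 3·F(−1/3) + 2·F(x′ + (3x + 1)/2) ≥ 3·F(x) + 2·F(x′). -/
/-- An odd function that is convex on `[0,1]` is concave on `[-1,0]`. -/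
theorem ConvexOn.concaveOn_Icc_neg_one_zero_of_odd {F : ℝ → ℝ}
    (hodd : ∀ x ∈ Set.Icc (-1 : ℝ) 1, F (-x) = -F x)
    (hconv : ConvexOn ℝ (Set.Icc (0 : ℝ) 1) F) :
    ConcaveOn ℝ (Set.Icc (-1 : ℝ) 0) F := by
  refine ⟨convex_Icc _ _, fun x hx y hy a b ha hb hab => ?_⟩
  have hz := convex_Icc (-1 : ℝ) 0 hx hy ha hb hab
  have h := hconv.2 (x := -x) (y := -y) ⟨by linarith [hx.2], by linarith [hx.1]⟩
    ⟨by linarith [hy.2], by linarith [hy.1]⟩ ha hb hab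
  rw [smul_neg, smul_neg, ← neg_add, hodd _ ⟨hz.1, by linarith [hz.2]⟩,
    hodd x ⟨hx.1, by linarith [hx.2]⟩, hodd y ⟨hy.1, by linarith [hy.2]⟩] at h
  simp only [smul_eq_mul] at h ⊢
  linarith

/-- Merging a `(x,x,x)` constraint with a `(x′,x′,1)` constraint for
MAX NAE-{3}-SAT: for `F : [−1,1] → ℝ` odd and convex on `[0,1]`:
(i) if `x ∈ [−1/3,0]`, `x′ ∈ [−1,0]` and `(3x+2x′)/5 ≥ −1/3`, then
`5·F((3x+2x′)/5) ≥ 3·F(x) + 2·F(x′)`;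
(ii) if `x ∈ [−1/3,0]`, `x′ ∈ [−1,−1/3]` and `(3x+2x′)/5 ≤ −1/3`, then
`3·F(−1/3) + 2·F(x′+(3x+1)/2) ≥ 3·F(x) + 2·F(x′)`. -/
theorem nae3_merging_lemma (F : ℝ → ℝ)
    (hodd : ∀ x ∈ Set.Icc (-1 : ℝ) 1, F (-x) = -F x)
    (hconv : ConvexOn ℝ (Set.Icc (0 : ℝ) 1) F) :
    (∀ x x' : ℝ, x ∈ Set.Icc (-(1/3) : ℝ) 0 → x' ∈ Set.Icc (-1 : ℝ) 0 →
      (3 * x + 2 * x') / 5 ≥ -(1/3) →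
      5 * F ((3 * x + 2 * x') / 5) ≥ 3 * F x + 2 * F x') ∧
    (∀ x x' : ℝ, x ∈ Set.Icc (-(1/3) : ℝ) 0 → x' ∈ Set.Icc (-1 : ℝ) (-(1/3)) →
      (3 * x + 2 * x') / 5 ≤ -(1/3) →
      3 * F (-(1/3)) + 2 * F (x' + (3 * x + 1) / 2) ≥ 3 * F x + 2 * F x') := by
  have hconc := hconv.concaveOn_Icc_neg_one_zero_of_odd hodd
  constructor
  · intro x x' hx hx' _
    have h := hconc.2 (x := x) (y := x') ⟨by linarith [hx.1], hx.2⟩ hx'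
      (show (0 : ℝ) ≤ 3 / 5 by norm_num) (show (0 : ℝ) ≤ 2 / 5 by norm_num) (by norm_num)
    simp only [smul_eq_mul] at h
    rw [show (3 * x + 2 * x') / 5 = 3 / 5 * x + 2 / 5 * x' by ring]
    linarith
  · intro x x' hx hx' hle
    obtain ⟨hx1, hx0⟩ := hx
    obtain ⟨hx'1, hx'3⟩ := hx'
    rcases (hx'3.trans hx1).eq_or_lt with heq | hlt
    · obtain rfl : x = -(1/3) := by linarith
      obtain rfl : x' = -(1/3) := by linarith
      norm_num
    have hL : 0 < x - x' := sub_pos.2 hlt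
    have key : ∀ z, x' ≤ z → z ≤ x →
        (z - x') / (x - x') * F x + (x - z) / (x - x') * F x' ≤ F z := by
      intro z h1 h2
      have h := hconc.2 (x := x) (y := x') ⟨by linarith, hx0⟩ ⟨hx'1, by linarith⟩
        (div_nonneg (sub_nonneg.2 h1) hL.le) (div_nonneg (sub_nonneg.2 h2) hL.le)
        (by field_simp; ring)
      simp only [smul_eq_mul] at h
      rwa [show (z - x') / (x - x') * x + (x - z) / (x - x') * x' = z by
        field_simp; ring] at h
    have hc := key (-(1/3)) hx'3 hx1
    have hy := key (x' + (3 * x + 1) / 2) (by linarith) (by linarith)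
    have e : 3 * ((-(1/3) - x') / (x - x') * F x + (x - -(1/3)) / (x - x') * F x') +
        2 * ((x' + (3 * x + 1) / 2 - x') / (x - x') * F x +
          (x - (x' + (3 * x + 1) / 2)) / (x - x') * F x') = 3 * F x + 2 * F x' := by
      field_simp
      ring
    linarith
end

section
/- Let F : [−1,1] → ℝ be an odd function that is convex on [0,1], and let x, x′ ∈ [−1,1] satisfy |x′| < x ≤ 1. Then F(1) + 2·F(x′ + (x − 1)/2) ≥ F(x) + 2·F(x′). (Note x′ + (x−1)/2 > −1, so all arguments lie in [−1,1].) -/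
/-- The chord inequality for a convex function, with denominators cleared. -/
theorem ConvexOn.sub_mul_le_chord {s : Set ℝ} {F : ℝ → ℝ} (hF : ConvexOn ℝ s F) {a b t : ℝ}
    (ha : a ∈ s) (hb : b ∈ s) (hat : a ≤ t) (htb : t ≤ b) :
    (b - a) * F t ≤ (b - t) * F a + (t - a) * F b := by
  rcases (hat.trans htb).eq_or_lt with rfl | hab
  · obtain rfl := le_antisymm hat htb
    simp
  have hL : 0 < b - a := sub_pos.2 hab
  have h := hF.2 ha hb (div_nonneg (sub_nonneg.2 htb) hL.le) (div_nonneg (sub_nonneg.2 hat) hL.le)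
    (by field_simp; ring)
  have ht : (b - t) / (b - a) * a + (t - a) / (b - a) * b = t := by field_simp; ring
  simp only [smul_eq_mul, ht] at h
  calc (b - a) * F t ≤ (b - a) * ((b - t) / (b - a) * F a + (t - a) / (b - a) * F b) :=
        mul_le_mul_of_nonneg_left h hL.le
    _ = (b - t) * F a + (t - a) * F b := by field_simp

/-- A convex function on `s` increases at least as fast on average over `[x, x + 2d]` as over
`[a, a + d]` when `a ≤ x`. -/
theorem ConvexOn.add_two_mul_le {s : Set ℝ} {F : ℝ → ℝ} (hF : ConvexOn ℝ s F) {a d x : ℝ}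
    (ha : a ∈ s) (hx : x + 2 * d ∈ s) (hd : 0 ≤ d) (hax : a ≤ x) :
    F x + 2 * F (a + d) ≤ F (x + 2 * d) + 2 * F a := by
  rcases hd.eq_or_lt with rfl | hd
  · simp
  have h₁ := hF.sub_mul_le_chord ha hx hax (by linarith)
  have h₂ := hF.sub_mul_le_chord (t := a + d) ha hx (by linarith) (by linarith)
  have hL : 0 < x + 2 * d - a := by linarith
  refine le_of_mul_le_mul_left ?_ hL
  linarith

/-- A convex function that is nonpositive at `0` is superadditive on nonnegative reals. -/
theorem ConvexOn.add_le_map_add {s : Set ℝ} {F : ℝ → ℝ} (hF : ConvexOn ℝ s F) (h0 : F 0 ≤ 0)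
    {u v : ℝ} (hs : 0 ∈ s) (huv : u + v ∈ s) (hu : 0 < u) (hv : 0 < v) :
    F u + F v ≤ F (u + v) := by
  have h₁ := hF.sub_mul_le_chord (t := u) hs huv hu.le (by linarith)
  have h₂ := hF.sub_mul_le_chord (t := v) hs huv hv.le (by linarith)
  have h₃ : (u + v) * F 0 ≤ 0 := mul_nonpos_of_nonneg_of_nonpos (by linarith) h0
  refine le_of_mul_le_mul_left ?_ (add_pos hu hv)
  linarith

/-- Third adjustment lemma for a single MAX NAE-{3}-SAT constraint: for
`F : [−1,1] → ℝ` odd and convex on `[0,1]`, and `x, x′ ∈ [−1,1]` with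
`|x′| < x ≤ 1`, one has `F(1) + 2·F(x′ + (x−1)/2) ≥ F(x) + 2·F(x′)`. -/
theorem nae3_third_adjustment (F : ℝ → ℝ)
    (hodd : ∀ x ∈ Set.Icc (-1 : ℝ) 1, F (-x) = -F x)
    (hconv : ConvexOn ℝ (Set.Icc (0 : ℝ) 1) F)
    (x x' : ℝ) (hx : x ∈ Set.Icc (-1 : ℝ) 1) (hx' : x' ∈ Set.Icc (-1 : ℝ) 1)
    (h1 : |x'| < x) (h2 : x ≤ 1) :
    F 1 + 2 * F (x' + (x - 1) / 2) ≥ F x + 2 * F x' := by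
  obtain ⟨h3, h4⟩ := abs_lt.1 h1
  have hF0 : F 0 = 0 := by
    have h := hodd 0 (by norm_num)
    rw [neg_zero] at h
    linarith
  obtain ⟨d, rfl⟩ : ∃ d, x = 1 - 2 * d := ⟨(1 - x) / 2, by ring⟩
  have hd : 0 ≤ d := by linarith
  have key : ∀ a, 0 ≤ a → a ≤ 1 - 2 * d →
      F (1 - 2 * d) + 2 * F (a + d) ≤ F 1 + 2 * F a := fun a ha hax => by
    simpa using hconv.add_two_mul_le (x := 1 - 2 * d) (d := d) ⟨ha, by linarith⟩
      (by simp) hd hax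
  rw [show x' + (1 - 2 * d - 1) / 2 = x' - d by ring, ge_iff_le]
  rcases le_or_gt 0 (x' - d) with hy | hy
  · simpa using key (x' - d) hy (by linarith)
  have hodd₁ := hodd (x' - d) ⟨by linarith, by linarith⟩
  rw [neg_sub] at hodd₁
  rcases le_or_gt x' 0 with hx0 | hx0
  · have h := key (-x') (by linarith) (by linarith)
    rw [hodd x' hx', neg_add_eq_sub] at h
    linarith
  · have h := key 0 le_rfl (by linarith)
    have hsup := hconv.add_le_map_add hF0.le (u := x') (v := d - x') (by simp)
      ⟨by linarith, by linarith⟩ hx0 (by linarith)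
    rw [add_sub_cancel] at hsup
    rw [zero_add] at h
    linarith
end

section
/- Let F : [−1,1] → ℝ be an odd function that is convex on [0,1], and let x, x′ ∈ [−1,1] satisfy 0 < |x′| ≤ x ≤ 1. Then F(x + x′ − 1) + F(1) ≥ F(x) + F(x′). (Note x + x′ − 1 ∈ [−1,1].) -/
/-- A convex function on a set of reals has a larger sum at the endpoints of an interval than at
two interior points with the same midpoint. -/
lemma ConvexOn.add_le_add_of_add_eq {s : Set ℝ} {f : ℝ → ℝ} (hf : ConvexOn ℝ s f)
    {a b u v : ℝ} (ha : a ∈ s) (hb : b ∈ s) (hau : a ≤ u) (hub : u ≤ b) (huv : u + v = a + b) :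
    f u + f v ≤ f a + f b := by
  obtain ⟨p, q, hp, hq, hpq, rfl⟩ : u ∈ segment ℝ a b := by
    rw [segment_eq_Icc (hau.trans hub)]
    exact ⟨hau, hub⟩
  obtain rfl : v = q • a + p • b := by
    simp only [smul_eq_mul] at huv ⊢
    linear_combination huv - (a + b) * hpq
  have hu := hf.2 ha hb hp hq hpq
  have hv := hf.2 ha hb hq hp (by rwa [add_comm])
  simp only [smul_eq_mul] at hu hv ⊢
  linear_combination hu + hv + (f a + f b) * hpq

/-- For `F : [−1,1] → ℝ` odd and convex on `[0,1]`, and `x, x′ ∈ [−1,1]` with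
`0 < |x′| ≤ x ≤ 1`, one has `F(x + x′ − 1) + F(1) ≥ F(x) + F(x′)`. -/
theorem bias_push_to_one (F : ℝ → ℝ)
    (hodd : ∀ x ∈ Set.Icc (-1 : ℝ) 1, F (-x) = -F x)
    (hconv : ConvexOn ℝ (Set.Icc (0 : ℝ) 1) F)
    (x x' : ℝ) (hx : x ∈ Set.Icc (-1 : ℝ) 1) (hx' : x' ∈ Set.Icc (-1 : ℝ) 1)
    (h0 : 0 < |x'|) (h1 : |x'| ≤ x) (h2 : x ≤ 1) :
    F (x + x' - 1) + F 1 ≥ F x + F x' := by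
  obtain ⟨hneg, hpos⟩ := abs_le.1 h1
  have one_mem : (1 : ℝ) ∈ Set.Icc (0 : ℝ) 1 := by simp
  have zero_mem : (0 : ℝ) ∈ Set.Icc (0 : ℝ) 1 := by simp
  rcases le_total 0 x' with hx'0 | hx'0
  · rcases le_total 0 (x + x' - 1) with hs | hs
    · exact hconv.add_le_add_of_add_eq ⟨hs, by linarith⟩ one_mem (by linarith) h2 (by ring)
    · have hF0 : F 0 = 0 := by
        have := hodd 0 (by simp)
        rw [neg_zero] at this
        linarith
      have hxx' := hconv.add_le_add_of_add_eq (u := x) (v := x') zero_mem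
        (b := x + x') ⟨by linarith, by linarith⟩ (by linarith) (by linarith) (by ring)
      have hsum := hconv.add_le_add_of_add_eq (u := x + x') (v := -(x + x' - 1)) zero_mem one_mem
        (by linarith) (by linarith) (by ring)
      have hF := hodd (x + x' - 1) ⟨by linarith, by linarith⟩
      linarith
  · have hF := hodd (x + x' - 1) ⟨by linarith, by linarith⟩
    have hF' := hodd x' hx'
    have h := hconv.add_le_add_of_add_eq (u := x) (v := -(x + x' - 1)) (a := -x')
      ⟨by linarith, by linarith⟩ one_mem (by linarith) h2 (by ring)
    linarith
end

section
/- Fix k ≥ 1 and let P_k ⊆ ℝ^k be the set of all vectors ( ∫ f(x)H₁(x)φ(x)dx, ∫ f(x)H₃(x)φ(x)dx, …, ∫ f(x)H_{2k−1}(x)φ(x)dx ) as f ranges over all measurable functions f : ℝ → [−1,1]. Then every point c ∈ P_k is attained by a step function: there exists a measurable g : ℝ → [−1,1] that is piecewise constant with at most 2k² pieces (i.e., there are finitely many real breakpoints, at most 2k² − 1 of them, such that g is constant on each complementary open interval) with ( ∫ g·H_{2i−1}·φ )_{i=1}^{k} = c. -/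
open MeasureTheory

/-- The standard Gaussian density on `ℝ`. -/
noncomputable def gaussDensity (x : ℝ) : ℝ :=
  (1 / Real.sqrt (2 * Real.pi)) * Real.exp (-x ^ 2 / 2)

/-- The number `m_ℓ(K_n) = n!/(ℓ!·2^ℓ·(n−2ℓ)!)` of `ℓ`-matchings of `K_n`. -/
noncomputable def matchingNumber (n l : ℕ) : ℝ :=
  (Nat.factorial n : ℝ) /
    ((Nat.factorial l : ℝ) * 2 ^ l * (Nat.factorial (n - 2 * l) : ℝ))

/-- The `n`-th normalized probabilists' Hermite polynomial. -/
noncomputable def hermiteN (n : ℕ) (x : ℝ) : ℝ :=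
  (1 / Real.sqrt (Nat.factorial n)) *
    ∑ l ∈ Finset.range (n / 2 + 1), (-1 : ℝ) ^ l * matchingNumber n l * x ^ (n - 2 * l)

lemma measurable_coe_sign : Measurable fun x : ℝ ↦ ((SignType.sign x : SignType) : ℝ) := by
  have h : (fun x : ℝ ↦ ((SignType.sign x : SignType) : ℝ)) =
      fun x ↦ if 0 < x then 1 else if x < 0 then -1 else 0 := by
    ext x
    rw [sign_apply]
    split_ifs <;> simp
  rw [h]
  exact Measurable.ite measurableSet_Ioi measurable_const
    (Measurable.ite measurableSet_Iio measurable_const measurable_const)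

lemma abs_coe_sign_le_one (x : ℝ) : |((SignType.sign x : SignType) : ℝ)| ≤ 1 := by
  rcases lt_trichotomy x 0 with h | h | h <;> simp [h]

section SignRepresentation

variable {α ι : Type*} [MeasurableSpace α] {μ : Measure α}

/-- The `L¹` norm is differentiable along lines through functions with a negligible zero set. -/
lemma hasDerivAt_integral_abs_add_mul {v w : α → ℝ} (hv : Integrable v μ) (hw : Integrable w μ)
    (hne : ∀ᵐ x ∂μ, v x ≠ 0) :
    HasDerivAt (fun t : ℝ ↦ ∫ x, |v x + t * w x| ∂μ)
      (∫ x, (SignType.sign (v x) : ℝ) * w x ∂μ) 0 := by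
  refine (hasDerivAt_integral_of_dominated_loc_of_lip (s := Set.univ) (bound := w)
    Filter.univ_mem ?_ ?_ ?_ ?_ hw ?_).2
  · exact .of_forall fun t ↦ (hv.add (hw.const_mul t)).abs.aestronglyMeasurable
  · simpa using hv.abs
  · exact (measurable_coe_sign.comp_aemeasurable hv.aemeasurable).aestronglyMeasurable.mul
      hw.aestronglyMeasurable
  · refine .of_forall fun x ↦ LipschitzOnWith.of_dist_le_mul fun s _ t _ ↦ ?_
    simp only [Real.dist_eq, Real.coe_nnabs]
    refine (abs_abs_sub_abs_le_abs_sub _ _).trans_eq ?_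
    rw [← abs_mul]
    congr 1
    ring
  · filter_upwards [hne] with x hx
    have hlin : HasDerivAt (fun t : ℝ ↦ v x + t * w x) (w x) 0 := by
      simpa using ((hasDerivAt_id (0 : ℝ)).mul_const (w x)).const_add (v x)
    exact HasDerivAt.comp (0 : ℝ) (by simpa using hasDerivAt_abs hx) hlin

variable [Fintype ι] {u : ι → α → ℝ}

lemma integrable_sum_mul (hu : ∀ i, Integrable (u i) μ) (a : ι → ℝ) :
    Integrable (fun x ↦ ∑ i, a i * u i x) μ :=
  integrable_finsetSum _ fun i _ ↦ (hu i).const_mul (a i)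

lemma continuous_integral_abs_sum_mul (hu : ∀ i, Integrable (u i) μ) :
    Continuous fun a : ι → ℝ ↦ ∫ x, |∑ i, a i * u i x| ∂μ := by
  refine (LipschitzWith.of_le_add_mul (Real.toNNReal (∑ i, ∫ x, |u i x| ∂μ))
    fun a b ↦ ?_).continuous
  rw [Real.coe_toNNReal _ (Finset.sum_nonneg fun i _ ↦ integral_nonneg fun x ↦ abs_nonneg _),
    ← integral_finsetSum _ fun i _ ↦ (hu i).abs, ← integral_mul_const,
    ← integral_add (integrable_sum_mul hu b).abs
      ((integrable_finsetSum _ fun i _ ↦ (hu i).abs).mul_const _)]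
  refine integral_mono (integrable_sum_mul hu a).abs ((integrable_sum_mul hu b).abs.add
    ((integrable_finsetSum _ fun i _ ↦ (hu i).abs).mul_const _)) fun x ↦ ?_
  have hsplit : ∑ i, a i * u i x = ∑ i, b i * u i x + ∑ i, (a i - b i) * u i x := by
    rw [← Finset.sum_add_distrib]
    exact Finset.sum_congr rfl fun i _ ↦ by ring
  simp only [hsplit]
  refine (abs_add_le _ _).trans (add_le_add le_rfl ?_)
  rw [Finset.sum_mul]
  refine (Finset.abs_sum_le_sum_abs _ _).trans (Finset.sum_le_sum fun i _ ↦ ?_)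
  rw [abs_mul, mul_comm]
  exact mul_le_mul_of_nonneg_left (by simpa [Real.dist_eq] using dist_le_pi_dist a b i)
    (abs_nonneg _)

lemma integral_abs_sum_smul (a : ι → ℝ) (t : ℝ) :
    ∫ x, |∑ i, (t • a) i * u i x| ∂μ = |t| * ∫ x, |∑ i, a i * u i x| ∂μ := by
  rw [← integral_const_mul]
  refine integral_congr_ae (.of_forall fun x ↦ ?_)
  simp only [Pi.smul_apply, smul_eq_mul, mul_assoc, ← Finset.mul_sum, abs_mul]

lemma exists_pos_mul_norm_le_integral_abs (hμ : μ ≠ 0) (hu : ∀ i, Integrable (u i) μ)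
    (hne : ∀ a : ι → ℝ, a ≠ 0 → ∀ᵐ x ∂μ, ∑ i, a i * u i x ≠ 0) :
    ∃ δ > 0, ∀ a : ι → ℝ, δ * ‖a‖ ≤ ∫ x, |∑ i, a i * u i x| ∂μ := by
  obtain ⟨δ, hδ, hmin⟩ := (isCompact_sphere (0 : ι → ℝ) 1).exists_forall_le' (a := 0)
    (continuous_integral_abs_sum_mul hu).continuousOn fun a ha ↦ by
      have ha0 : a ≠ 0 := by
        rintro rfl
        simp at ha
      refine (integral_nonneg fun x ↦ abs_nonneg _).lt_of_ne fun h0 ↦ hμ ?_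
      have hz := (integral_eq_zero_iff_of_nonneg (fun x ↦ abs_nonneg _)
        (integrable_sum_mul hu a).abs).1 h0.symm
      rw [← ae_eq_bot, ← Filter.eventually_false_iff_eq_bot]
      filter_upwards [hz, hne a ha0] with x h1 h2
      exact h2 (abs_eq_zero.1 h1)
  refine ⟨δ, hδ, fun a ↦ ?_⟩
  rcases eq_or_ne a 0 with rfl | ha
  · simp
  have hn : ‖a‖ ≠ 0 := norm_ne_zero_iff.2 ha
  have h := hmin (‖a‖⁻¹ • a) (by simp [norm_smul, hn])
  rw [integral_abs_sum_smul, abs_of_nonneg (by positivity)] at h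
  rwa [← div_eq_inv_mul, le_div_iff₀ (by positivity)] at h

/-- The moments of a function bounded by `1` against a finite family whose nontrivial combinations
vanish only on null sets are also the moments of a multiple of the sign of such a combination. -/
theorem exists_moments_eq_mul_sign (hμ : μ ≠ 0) (hu : ∀ i, Integrable (u i) μ)
    (hne : ∀ a : ι → ℝ, a ≠ 0 → ∀ᵐ x ∂μ, ∑ i, a i * u i x ≠ 0)
    {f : α → ℝ} (hf : Measurable f) (hf1 : ∀ x, |f x| ≤ 1) :
    ∃ (a : ι → ℝ) (r : ℝ), 0 ≤ r ∧ r ≤ 1 ∧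
      ∀ i, ∫ x, r * (SignType.sign (∑ j, a j * u j x) : ℝ) * u i x ∂μ = ∫ x, f x * u i x ∂μ := by
  classical
  set c : ι → ℝ := fun i ↦ ∫ x, f x * u i x ∂μ with hc
  set F : (ι → ℝ) → ℝ := fun a ↦ ∫ x, |∑ i, a i * u i x| ∂μ with hF
  have hF0 : ∀ a, 0 ≤ F a := fun a ↦ integral_nonneg fun x ↦ abs_nonneg _
  have hfu : ∀ {v : α → ℝ}, Integrable v μ → Integrable (fun x ↦ f x * v x) μ := fun hv ↦
    hv.bdd_mul (c := 1) hf.aestronglyMeasurable (.of_forall hf1)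
  have hpair : ∀ a : ι → ℝ, ∑ i, a i * c i ≤ F a := fun a ↦ by
    calc ∑ i, a i * c i = ∫ x, f x * ∑ i, a i * u i x ∂μ := by
          simp only [hc, ← integral_const_mul]
          rw [← integral_finsetSum _ fun i _ ↦ (hfu (hu i)).const_mul (a i)]
          refine integral_congr_ae (.of_forall fun x ↦ ?_)
          simp only [Finset.mul_sum]
          exact Finset.sum_congr rfl fun i _ ↦ by ring
      _ ≤ F a := by
          refine integral_mono (hfu (integrable_sum_mul hu a)) (integrable_sum_mul hu a).abs
            fun x ↦ ?_
          refine (le_abs_self _).trans ?_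
          rw [abs_mul]
          exact mul_le_of_le_one_left (abs_nonneg _) (hf1 x)
  obtain ⟨δ, hδ, hlow⟩ := exists_pos_mul_norm_le_integral_abs hμ hu hne
  obtain ⟨a, ha⟩ : ∃ a : ι → ℝ, ∀ b : ι → ℝ,
      F a ^ 2 / 2 - ∑ i, a i * c i ≤ F b ^ 2 / 2 - ∑ i, b i * c i := by
    refine Continuous.exists_forall_le_of_isBounded
      (f := fun a : ι → ℝ ↦ F a ^ 2 / 2 - ∑ i, a i * c i) ?_ 0 ?_
    · exact (((continuous_integral_abs_sum_mul hu).pow 2).div_const 2).sub (by fun_prop)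
    · refine (Metric.isBounded_closedBall (x := (0 : ι → ℝ)) (r := 2 / δ)).subset fun b hb ↦ ?_
      have hb' : F b ^ 2 / 2 - ∑ i, b i * c i ≤ 0 := by simpa [hF] using hb
      have h2 : F b ≤ 2 := by nlinarith [hpair b, hF0 b]
      rw [mem_closedBall_zero_iff, le_div_iff₀ hδ]
      linarith [hlow b]
  have hcrit : ∀ i, F a * ∫ x, (SignType.sign (∑ j, a j * u j x) : ℝ) * u i x ∂μ = c i := by
    intro i
    have hline : ∀ t : ℝ, F (a + t • Pi.single i 1) =
        ∫ x, |∑ j, a j * u j x + t * u i x| ∂μ := fun t ↦ by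
      refine integral_congr_ae (.of_forall fun x ↦ ?_)
      simp [add_mul, Finset.sum_add_distrib, Pi.single_apply]
    have hsum : ∀ t : ℝ, ∑ j, (a + t • Pi.single i 1 : ι → ℝ) j * c j =
        ∑ j, a j * c j + t * c i := fun t ↦ by
      simp [add_mul, Finset.sum_add_distrib, Pi.single_apply]
    have hmin : IsLocalMin (fun t : ℝ ↦ F (a + t • Pi.single i 1) ^ 2 / 2 -
        ∑ j, (a + t • Pi.single i 1 : ι → ℝ) j * c j) 0 :=
      .of_forall fun t ↦ by
        simpa only [zero_smul, add_zero] using ha (a + t • Pi.single i 1)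
    have hder : HasDerivAt (fun t : ℝ ↦ F (a + t • Pi.single i 1) ^ 2 / 2)
        (F a * ∫ x, (SignType.sign (∑ j, a j * u j x) : ℝ) * u i x ∂μ) 0 := by
      rcases eq_or_ne a 0 with rfl | ha0
      · have hsq : ∀ t : ℝ, F (0 + t • Pi.single i 1) ^ 2 / 2 =
            t ^ 2 * (F (Pi.single i 1) ^ 2 / 2) := fun t ↦ by
          rw [zero_add]
          simp only [hF]
          rw [integral_abs_sum_smul, mul_pow, sq_abs]
          ring
        simp only [hsq]
        simpa using (hasDerivAt_pow 2 (0 : ℝ)).mul_const (F (Pi.single i 1) ^ 2 / 2)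
      · simp only [hline]
        have h := ((hasDerivAt_integral_abs_add_mul (integrable_sum_mul hu a) (hu i)
          (hne a ha0)).pow 2).div_const 2
        convert! h using 1
        simp [hF]
        ring
    have h := hmin.hasDerivAt_eq_zero (hder.sub (by
      simp only [hsum]
      simpa using ((hasDerivAt_id (0 : ℝ)).mul_const (c i)).const_add (∑ j, a j * c j)))
    linarith
  have hsgn : ∀ i, Integrable
      (fun x ↦ (SignType.sign (∑ j, a j * u j x) : ℝ) * u i x) μ := fun i ↦
    (hu i).bdd_mul (c := 1) (measurable_coe_sign.comp_aemeasurable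
      (integrable_sum_mul hu a).aemeasurable).aestronglyMeasurable
      (.of_forall fun x ↦ abs_coe_sign_le_one _)
  have heuler : F a * F a = ∑ i, a i * c i := by
    simp only [← hcrit, mul_left_comm _ (F a)]
    rw [← Finset.mul_sum]
    simp only [← integral_const_mul]
    rw [← integral_finsetSum _ fun i _ ↦ (hsgn i).const_mul (a i)]
    congr 1
    refine integral_congr_ae (.of_forall fun x ↦ ?_)
    simp only [mul_left_comm (a _), ← Finset.mul_sum, sign_mul_self]
  refine ⟨a, F a, hF0 a, ?_, fun i ↦ ?_⟩
  · nlinarith [hpair a, hF0 a]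
  · simp only [mul_assoc, integral_const_mul]
    exact hcrit i

end SignRepresentation

section Hermite

open Polynomial

/-- The polynomial whose evaluation is `hermiteN n`. -/
noncomputable def hermiteNPoly (n : ℕ) : ℝ[X] :=
  C (1 / Real.sqrt (Nat.factorial n)) *
    ∑ l ∈ Finset.range (n / 2 + 1), C ((-1 : ℝ) ^ l * matchingNumber n l) * X ^ (n - 2 * l)

lemma eval_hermiteNPoly (n : ℕ) (x : ℝ) : (hermiteNPoly n).eval x = hermiteN n x := by
  simp [hermiteNPoly, hermiteN, eval_finsetSum]

lemma degree_hermiteNPoly (n : ℕ) : (hermiteNPoly n).degree = n := by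
  have hlow : degree (∑ l ∈ Finset.range (n / 2),
      C ((-1 : ℝ) ^ (l + 1) * matchingNumber n (l + 1)) * X ^ (n - 2 * (l + 1))) <
        (n : WithBot ℕ) := by
    refine (degree_sum_le _ _).trans_lt
      ((Finset.sup_lt_iff (WithBot.bot_lt_coe n)).2 fun l hl ↦ ?_)
    refine (degree_C_mul_X_pow_le _ _).trans_lt (Nat.cast_lt.2 ?_)
    have := Finset.mem_range.1 hl
    omega
  have hlead : (-1 : ℝ) ^ 0 * matchingNumber n 0 = 1 := by
    simp [matchingNumber, Nat.factorial_ne_zero]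
  unfold hermiteNPoly
  rw [degree_C_mul (by positivity), Finset.sum_range_succ', hlead, add_comm,
    degree_add_eq_left_of_degree_lt (by simpa using hlow)]
  simp

/-- The polynomials `hermiteNPoly n` as a polynomial sequence. -/
noncomputable def hermiteNSequence : Polynomial.Sequence ℝ := ⟨hermiteNPoly, degree_hermiteNPoly⟩

variable {k : ℕ}

/-- The combination of the first `k` odd Hermite polynomials with coefficients `a`. -/
noncomputable def oddHermiteSum (a : Fin k → ℝ) : ℝ[X] :=
  ∑ i, a i • hermiteNPoly (2 * i + 1)

lemma eval_oddHermiteSum (a : Fin k → ℝ) (x : ℝ) :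
    (oddHermiteSum a).eval x = ∑ i, a i * hermiteN (2 * i + 1) x := by
  simp [oddHermiteSum, eval_finsetSum, eval_hermiteNPoly]

lemma oddHermiteSum_ne_zero {a : Fin k → ℝ} (ha : a ≠ 0) : oddHermiteSum a ≠ 0 := by
  intro h
  have hli : LinearIndependent ℝ fun i : Fin k ↦ hermiteNPoly (2 * i + 1) :=
    hermiteNSequence.linearIndependent.comp (fun i : Fin k ↦ 2 * (i : ℕ) + 1)
      fun i j hij ↦ Fin.ext (by simpa using hij)
  exact ha (funext (Fintype.linearIndependent_iff.1 hli a h))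

lemma natDegree_oddHermiteSum_le (a : Fin k → ℝ) : (oddHermiteSum a).natDegree ≤ 2 * k - 1 := by
  refine natDegree_sum_le_of_forall_le _ _ fun i _ ↦ (natDegree_smul_le _ _).trans ?_
  rw [natDegree_eq_of_degree_eq_some (degree_hermiteNPoly _)]
  omega

lemma gaussDensity_pos (x : ℝ) : 0 < gaussDensity x := by
  unfold gaussDensity
  positivity

lemma integrable_eval_mul_gaussDensity (p : ℝ[X]) :
    Integrable fun x ↦ p.eval x * gaussDensity x := by
  have hpow : ∀ n : ℕ, Integrable fun x : ℝ ↦ x ^ n * gaussDensity x := fun n ↦ by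
    have h := (integrable_rpow_mul_exp_neg_mul_sq (b := 1 / 2) (by norm_num) (s := n)
      (by linarith [n.cast_nonneg (α := ℝ)])).const_mul (1 / Real.sqrt (2 * Real.pi))
    refine h.congr (.of_forall fun x ↦ ?_)
    simp only [gaussDensity, Real.rpow_natCast]
    rw [mul_left_comm]
    congr 3
    ring
  simp only [eval_eq_sum_range, Finset.sum_mul, mul_assoc]
  exact integrable_finsetSum _ fun n _ ↦ (hpow n).const_mul _

/-- The sign of a polynomial is constant between consecutive roots. -/
lemma sign_eval_eq_of_roots_same_side (p : ℝ[X]) {x y : ℝ} (hx : x ∉ p.roots.toFinset)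
    (hy : y ∉ p.roots.toFinset) (h : ∀ t ∈ p.roots.toFinset, (x < t ↔ y < t)) :
    SignType.sign (p.eval x) = SignType.sign (p.eval y) := by
  rcases eq_or_ne p 0 with rfl | hp
  · simp
  wlog hxy : x ≤ y generalizing x y
  · exact (this hy hx (fun t ht ↦ (h t ht).symm) (le_of_not_ge hxy)).symm
  simp only [Multiset.mem_toFinset, mem_roots hp, IsRoot.def] at hx hy h
  have hno : ∀ t ∈ Set.Icc x y, p.eval t ≠ 0 := fun t ht h0 ↦ by
    have hxt : x ≠ t := by
      rintro rfl
      exact hx h0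
    exact ((h t h0).1 (ht.1.lt_of_ne hxt)).not_ge ht.2
  rcases lt_or_gt_of_ne hx with h1 | h1 <;> rcases lt_or_gt_of_ne hy with h2 | h2
  · simp [h1, h2]
  · obtain ⟨t, ht, h0⟩ := intermediate_value_Icc hxy p.continuous.continuousOn ⟨h1.le, h2.le⟩
    exact absurd h0 (hno t ht)
  · obtain ⟨t, ht, h0⟩ := intermediate_value_Icc' hxy p.continuous.continuousOn ⟨h2.le, h1.le⟩
    exact absurd h0 (hno t ht)
  · simp [h1, h2]

end Hermite

/-- Every point of `P_k` (the set of vectors of the first `k` odd Hermite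
coefficients of measurable functions `f : ℝ → [−1,1]`) is attained by a step
function with at most `2k²` pieces (hence at most `2k² − 1` breakpoints). -/
theorem hermite_moments_attained_by_step_function (k : ℕ) (hk : 1 ≤ k)
    (c : Fin k → ℝ)
    (hc : ∃ f : ℝ → ℝ, Measurable f ∧ (∀ x, f x ∈ Set.Icc (-1 : ℝ) 1) ∧
      ∀ i : Fin k, (∫ x, f x * hermiteN (2 * (i : ℕ) + 1) x * gaussDensity x) = c i) :
    ∃ g : ℝ → ℝ, Measurable g ∧ (∀ x, g x ∈ Set.Icc (-1 : ℝ) 1) ∧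
      (∃ s : Finset ℝ, s.card ≤ 2 * k ^ 2 - 1 ∧
        ∀ x y : ℝ, x ∉ s → y ∉ s → (∀ t ∈ s, (x < t ↔ y < t)) → g x = g y) ∧
      ∀ i : Fin k, (∫ x, g x * hermiteN (2 * (i : ℕ) + 1) x * gaussDensity x) = c i := by
  obtain ⟨f, hf, hf1, hfc⟩ := hc
  have hsum : ∀ (a : Fin k → ℝ) (x : ℝ),
      ∑ i, a i * (hermiteN (2 * (i : ℕ) + 1) x * gaussDensity x) =
        (oddHermiteSum a).eval x * gaussDensity x := fun a x ↦ by
    simp only [eval_oddHermiteSum, Finset.sum_mul, mul_assoc]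
  obtain ⟨a, r, hr0, hr1, hmom⟩ := exists_moments_eq_mul_sign
    (u := fun (i : Fin k) x ↦ hermiteN (2 * (i : ℕ) + 1) x * gaussDensity x)
    (NeZero.ne (volume : Measure ℝ))
    (fun i ↦ by simpa only [eval_hermiteNPoly] using
      integrable_eval_mul_gaussDensity (hermiteNPoly (2 * (i : ℕ) + 1)))
    (fun a ha ↦ by
      have hnull := (oddHermiteSum a).roots.toFinset.finite_toSet.measure_zero volume
      filter_upwards [compl_mem_ae_iff.2 hnull] with x hx
      rw [hsum]
      refine mul_ne_zero (fun h0 ↦ hx ?_) (gaussDensity_pos x).ne'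
      simpa [Polynomial.mem_roots (oddHermiteSum_ne_zero ha)] using h0)
    hf fun x ↦ abs_le.2 (hf1 x)
  simp only [hsum, sign_mul, sign_pos (gaussDensity_pos _), mul_one] at hmom
  refine ⟨fun x ↦ r * (SignType.sign ((oddHermiteSum a).eval x) : ℝ),
    (measurable_coe_sign.comp (oddHermiteSum a).continuous.measurable).const_mul r, fun x ↦ ?_,
    ⟨(oddHermiteSum a).roots.toFinset, ?_, fun x y hx hy h ↦ ?_⟩, fun i ↦ ?_⟩
  · rw [Set.mem_Icc, ← abs_le, abs_mul, abs_of_nonneg hr0]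
    exact mul_le_one₀ hr1 (abs_nonneg _) (abs_coe_sign_le_one _)
  · refine (Multiset.toFinset_card_le _).trans ((Polynomial.card_roots' _).trans
      ((natDegree_oddHermiteSum_le a).trans (Nat.sub_le_sub_right ?_ 1)))
    exact Nat.mul_le_mul_left 2 (Nat.le_self_pow two_ne_zero k)
  · simp only [sign_eval_eq_of_roots_same_side _ hx hy h]
  · simpa only [mul_assoc] using (hmom i).trans (by simpa only [mul_assoc] using hfc i)
end

section
/- Let δ ∈ (0, 2), ε > 0, and let u, v₁, v₂, v₃, v₄ ∈ ℝⁿ be vectors satisfying v₂ + v₃ + v₄ = (2 − δ)·v₁ and ε ≤ |⟨vᵢ, u⟩| < 1.5ε for every i ∈ {1,2,3,4}. Then sign(⟨v₁,u⟩)·sign(⟨v₂,u⟩)·sign(⟨v₃,u⟩)·sign(⟨v₄,u⟩) = −1. -/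
/-- The dot product of two vectors in `ℝⁿ`. -/
def dot {n : ℕ} (u v : Fin n → ℝ) : ℝ := ∑ i, u i * v i

theorem dot_eq_dotProduct {n : ℕ} (u v : Fin n → ℝ) : dot u v = u ⬝ᵥ v := rfl

/-- If `b + c + d` is a multiple of `a > 0` by a factor in `(0, 2)` and all four numbers
have absolute value in `[ε, 1.5ε)`, then exactly one of `b`, `c`, `d` is negative. -/
theorem sign_mul_sign_mul_sign_of_pos {a b c d t ε : ℝ} (ht₀ : 0 < t) (ht₂ : t < 2)
    (ha : 0 < a) (ha' : a < 1.5 * ε) (hsum : b + c + d = t * a)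
    (hb : ε ≤ |b| ∧ |b| < 1.5 * ε) (hc : ε ≤ |c| ∧ |c| < 1.5 * ε)
    (hd : ε ≤ |d| ∧ |d| < 1.5 * ε) :
    b.sign * c.sign * d.sign = -1 := by
  have hlower : 0 < t * a := mul_pos ht₀ ha
  have hupper : t * a < 2 * a := mul_lt_mul_of_pos_right ht₂ ha
  have hε : 0 < ε := by linarith
  have sign_cases {x : ℝ} (hx : ε ≤ |x| ∧ |x| < 1.5 * ε) :
      (x.sign = 1 ∧ ε ≤ x ∧ x < 1.5 * ε) ∨ (x.sign = -1 ∧ ε ≤ -x ∧ -x < 1.5 * ε) := by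
    rcases lt_or_ge x 0 with h | h
    · rw [abs_of_neg h] at hx
      exact Or.inr ⟨Real.sign_of_neg h, hx⟩
    · rw [abs_of_nonneg h] at hx
      exact Or.inl ⟨Real.sign_of_pos (hε.trans_le hx.1), hx⟩
  rcases sign_cases hb with ⟨sb, hb, hb'⟩ | ⟨sb, hb, hb'⟩ <;>
    rcases sign_cases hc with ⟨sc, hc, hc'⟩ | ⟨sc, hc, hc'⟩ <;>
    rcases sign_cases hd with ⟨sd, hd, hd'⟩ | ⟨sd, hd, hd'⟩ <;>
    rw [sb, sc, sd] <;> first | norm_num; done | (exfalso; linarith)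

/-- Deterministic core of the example where `F₄` is negative on positive
biases: if `v₂ + v₃ + v₄ = (2−δ)v₁` for `δ ∈ (0,2)` and all four inner
products `⟨vᵢ,u⟩` lie in absolute value in `[ε, 1.5ε)` for some `ε > 0`, then
the product of their signs is `−1`. -/
theorem sign_product_neg_one (n : ℕ) (δ ε : ℝ)
    (hδ : δ ∈ Set.Ioo (0 : ℝ) 2) (hε : 0 < ε)
    (u : Fin n → ℝ) (v : Fin 4 → (Fin n → ℝ))
    (hsum : v 1 + v 2 + v 3 = (2 - δ) • v 0)
    (hband : ∀ i, ε ≤ |dot (v i) u| ∧ |dot (v i) u| < 1.5 * ε) :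
    (∏ i, Real.sign (dot (v i) u)) = -1 := by
  have hdot : dot (v 1) u + dot (v 2) u + dot (v 3) u = (2 - δ) * dot (v 0) u := by
    simp only [dot_eq_dotProduct, ← add_dotProduct, hsum, smul_dotProduct, smul_eq_mul]
  have ht₀ : 0 < 2 - δ := sub_pos.2 hδ.2
  have ht₂ : 2 - δ < 2 := sub_lt_self 2 hδ.1
  have h₀ := hband 0
  rw [Fin.prod_univ_four]
  rcases lt_or_ge (dot (v 0) u) 0 with h | h
  · rw [abs_of_neg h] at h₀
    have key := sign_mul_sign_mul_sign_of_pos ht₀ ht₂ (neg_pos.2 h) h₀.2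
      (b := -dot (v 1) u) (c := -dot (v 2) u) (d := -dot (v 3) u) (by linarith)
      (by simpa only [abs_neg] using hband 1) (by simpa only [abs_neg] using hband 2)
      (by simpa only [abs_neg] using hband 3)
    simp only [Real.sign_neg] at key
    rw [Real.sign_of_neg h]
    linarith
  · rw [abs_of_nonneg h] at h₀
    have hpos : 0 < dot (v 0) u := hε.trans_le h₀.1
    rw [Real.sign_of_pos hpos, one_mul]
    exact sign_mul_sign_mul_sign_of_pos ht₀ ht₂ hpos h₀.2 hdot (hband 1) (hband 2) (hband 3)
end

section
/- Let α ∈ (0,1) and ρ ∈ (−1,1). For measurable f : ℝ → [−1,1], define L(f) = ((1−α)/α)·∫_ℝ f(x)² φ(x) dx + ∫_{ℝ²} f(x) f(y) φ_ρ(x,y) dx dy. Then there exists a measurable f : ℝ → [−1,1] attaining the infimum: L(f) ≤ L(g) for every measurable g : ℝ → [−1,1]. -/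
open MeasureTheory

/-- The standard Gaussian density on `ℝ`. -/
noncomputable def phi (x : ℝ) : ℝ :=
  (1 / Real.sqrt (2 * Real.pi)) * Real.exp (-x ^ 2 / 2)

/-- The density of a centered bivariate Gaussian with unit variances and
correlation `ρ`. -/
noncomputable def phiRho (ρ x y : ℝ) : ℝ :=
  Real.exp (-(x ^ 2 - 2 * ρ * x * y + y ^ 2) / (2 * (1 - ρ ^ 2))) /
    (2 * Real.pi * Real.sqrt (1 - ρ ^ 2))

/-- The MAX CUT rounding functional
`L(f) = ((1−α)/α)·∫ f(x)² φ(x) dx + ∫∫ f(x)f(y) φ_ρ(x,y) dx dy`. -/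
noncomputable def Lfun (α ρ : ℝ) (f : ℝ → ℝ) : ℝ :=
  ((1 - α) / α) * (∫ x, (f x) ^ 2 * phi x) +
    ∫ p : ℝ × ℝ, f p.1 * f p.2 * phiRho ρ p.1 p.2

open Filter Topology ProbabilityTheory

/-- Weak-* sequential compactness of the unit ball of `L^∞` of a finite measure. -/
theorem exists_subseq_tendsto_integral_mul {X : Type*} [MeasurableSpace X]
    [MeasurableSpace.CountablyGenerated X] (μ : Measure X) [IsFiniteMeasure μ]
    (f : ℕ → X → ℝ) (hf : ∀ n, Measurable (f n)) (hf1 : ∀ n x, f n x ∈ Set.Icc (-1 : ℝ) 1) :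
    ∃ g : X → ℝ, Measurable g ∧ (∀ x, g x ∈ Set.Icc (-1 : ℝ) 1) ∧
      ∃ s : ℕ → ℕ, StrictMono s ∧ ∀ h : X → ℝ, MemLp h 2 μ →
        Tendsto (fun n => ∫ x, f (s n) x * h x ∂μ) atTop (𝓝 (∫ x, g x * h x ∂μ)) := by
  have hfL : ∀ n, MemLp (f n) 2 μ := fun n =>
    MemLp.of_bound (hf n).aestronglyMeasurable 1 (ae_of_all _ fun x => abs_le.2 (hf1 n x))
  set F : ℕ → Lp ℝ 2 μ := fun n => (hfL n).toLp (f n)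
  have : Fact ((2 : ENNReal) ≠ ⊤) := ⟨by simp⟩
  obtain ⟨R, hR⟩ : ∃ R : ℝ, ∀ n, ‖F n‖ ≤ R := by
    refine ⟨μ.real Set.univ ^ (ENNReal.toReal 2)⁻¹ * 1, fun n => ?_⟩
    refine Lp.norm_le_of_ae_bound zero_le_one ?_
    filter_upwards [(hfL n).coeFn_toLp] with x hx
    rw [hx]
    exact abs_le.2 (hf1 n x)
  have hball : ∀ n, StrongDual.toWeakDual (InnerProductSpace.toDual ℝ (Lp ℝ 2 μ) (F n)) ∈
      (WeakDual.toStrongDual ⁻¹' Metric.closedBall (0 : StrongDual ℝ (Lp ℝ 2 μ)) R) := by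
    intro n
    simpa using hR n
  obtain ⟨ℓ, -, s, hs, hlim⟩ := WeakDual.isSeqCompact_closedBall ℝ (Lp ℝ 2 μ) 0 R hball
  set G : Lp ℝ 2 μ := (InnerProductSpace.toDual ℝ (Lp ℝ 2 μ)).symm (WeakDual.toStrongDual ℓ)
  have hlim' : ∀ h : X → ℝ, MemLp h 2 μ →
      Tendsto (fun n => ∫ x, f (s n) x * h x ∂μ) atTop (𝓝 (∫ x, G x * h x ∂μ)) := by
    intro h hh
    have h1 : Tendsto (fun n => inner ℝ (F (s n)) (hh.toLp h)) atTop
        (𝓝 (inner ℝ G (hh.toLp h))) := by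
      have h2 := ((WeakDual.eval_continuous (𝕜 := ℝ) (hh.toLp h)).tendsto ℓ).comp hlim
      have h3 : inner ℝ G (hh.toLp h) = ℓ (hh.toLp h) :=
        InnerProductSpace.toDual_symm_apply (𝕜 := ℝ)
      rw [h3]
      exact h2
    have h4 : ∀ n, inner ℝ (F (s n)) (hh.toLp h) = ∫ x, f (s n) x * h x ∂μ := by
      intro n
      rw [L2.inner_def]
      refine integral_congr_ae ?_
      filter_upwards [(hfL (s n)).coeFn_toLp, hh.coeFn_toLp] with x hx hx'
      simp [F, hx, hx', mul_comm]
    have h5 : inner ℝ G (hh.toLp h) = ∫ x, G x * h x ∂μ := by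
      rw [L2.inner_def]
      refine integral_congr_ae ?_
      filter_upwards [hh.coeFn_toLp] with x hx'
      simp [hx', mul_comm]
    simpa only [h4, h5] using h1
  have hGi : Integrable G μ := (Lp.memLp G).integrable one_le_two
  have hset : ∀ t, MeasurableSet t →
      Tendsto (fun n => ∫ x in t, f (s n) x ∂μ) atTop (𝓝 (∫ x in t, G x ∂μ)) := by
    intro t ht
    have key : ∀ u : X → ℝ, ∫ x, u x * t.indicator (fun _ => 1) x ∂μ = ∫ x in t, u x ∂μ := by
      intro u
      rw [← integral_indicator ht]
      congr 1 with x
      by_cases hx : x ∈ t <;> simp [hx]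
    have := hlim' (t.indicator fun _ => 1) ((memLp_const (1 : ℝ)).indicator ht)
    simpa only [key] using this
  have hint : ∀ n, Integrable (f n) μ := fun n => (hfL n).integrable one_le_two
  have hle : G ≤ᵐ[μ] fun _ => (1 : ℝ) :=
    ae_le_of_forall_setIntegral_le hGi (integrable_const _) fun t ht _ =>
      le_of_tendsto' (hset t ht) fun n =>
        setIntegral_mono (hint _).integrableOn (integrable_const _).integrableOn
          fun x => (hf1 _ x).2
  have hge : (fun _ => (-1 : ℝ)) ≤ᵐ[μ] G :=
    ae_le_of_forall_setIntegral_le (integrable_const _) hGi fun t ht _ =>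
      ge_of_tendsto' (hset t ht) fun n =>
        setIntegral_mono (integrable_const _).integrableOn (hint _).integrableOn
          fun x => (hf1 _ x).1
  refine ⟨fun x => max (-1) (min 1 (G x)), ?_, fun x => ⟨le_max_left _ _, ?_⟩, s, hs, ?_⟩
  · exact measurable_const.max (measurable_const.min (Lp.stronglyMeasurable G).measurable)
  · exact max_le (by norm_num) (min_le_left _ _)
  · intro h hh
    convert hlim' h hh using 2
    refine integral_congr_ae ?_
    filter_upwards [hle, hge] with x h1 h2
    simp only [min_eq_right h1, max_eq_right h2]

theorem phi_eq_gaussianPDFReal (x : ℝ) : phi x = gaussianPDFReal 0 1 x := by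
  simp [phi, gaussianPDFReal]

theorem phi_pos (x : ℝ) : 0 < phi x := by
  rw [phi_eq_gaussianPDFReal]
  exact gaussianPDFReal_pos _ _ _ one_ne_zero

theorem integrable_phi : Integrable phi := by
  rw [funext phi_eq_gaussianPDFReal]
  exact integrable_gaussianPDFReal 0 1

theorem integral_gaussianReal_eq_integral_mul_phi (f : ℝ → ℝ) :
    ∫ x, f x ∂(gaussianReal 0 1) = ∫ x, f x * phi x := by
  rw [integral_gaussianReal_eq_integral_smul one_ne_zero]
  simp only [phi_eq_gaussianPDFReal, smul_eq_mul, mul_comm]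

theorem phiRho_nonneg (ρ x y : ℝ) : 0 ≤ phiRho ρ x y := by
  unfold phiRho
  positivity

theorem phiRho_comm (ρ x y : ℝ) : phiRho ρ x y = phiRho ρ y x := by
  unfold phiRho
  congr 4
  ring

theorem continuous_phiRho (ρ : ℝ) : Continuous fun p : ℝ × ℝ => phiRho ρ p.1 p.2 := by
  unfold phiRho
  fun_prop

theorem integrable_phiRho {ρ : ℝ} (hρ : ρ ∈ Set.Ioo (-1 : ℝ) 1) :
    Integrable fun p : ℝ × ℝ => phiRho ρ p.1 p.2 := by
  have hρ' : |ρ| < 1 := abs_lt.2 hρ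
  have h1 : 0 < 1 - ρ ^ 2 := by nlinarith [hρ.1, hρ.2]
  set a : ℝ := (1 - |ρ|) / (2 * (1 - ρ ^ 2)) with ha
  have ha0 : 0 < a := div_pos (by linarith) (by linarith)
  have hi := integrable_exp_neg_mul_sq ha0
  refine ((hi.mul_prod hi).div_const (2 * Real.pi * Real.sqrt (1 - ρ ^ 2))).mono'
    (continuous_phiRho ρ).aestronglyMeasurable (ae_of_all _ fun p => ?_)
  rw [Real.norm_of_nonneg (phiRho_nonneg _ _ _), phiRho, ← Real.exp_add]
  gcongr
  have h2 : -a * p.1 ^ 2 + -a * p.2 ^ 2 =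
      -((1 - |ρ|) * (p.1 ^ 2 + p.2 ^ 2)) / (2 * (1 - ρ ^ 2)) := by
    rw [ha]; ring
  rw [h2]
  gcongr
  rcases abs_cases ρ with ⟨h, _⟩ | ⟨h, _⟩ <;> rw [h] <;>
    nlinarith [sq_nonneg (p.1 - p.2), sq_nonneg (p.1 + p.2)]

theorem phiRho_div_phi_le {ρ : ℝ} (hρ : ρ ∈ Set.Ioo (-1 : ℝ) 1) (x y : ℝ) :
    phiRho ρ x y / phi y ≤
      Real.exp (x ^ 2 / 2) / (2 * Real.pi * Real.sqrt (1 - ρ ^ 2)) * Real.sqrt (2 * Real.pi) := by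
  have h1 : 0 < 1 - ρ ^ 2 := by nlinarith [hρ.1, hρ.2]
  rw [div_le_iff₀ (phi_pos y)]
  have h2 : 0 < Real.sqrt (2 * Real.pi) := by positivity
  have h3 : Real.exp (x ^ 2 / 2) / (2 * Real.pi * Real.sqrt (1 - ρ ^ 2)) *
      Real.sqrt (2 * Real.pi) * phi y =
      Real.exp (x ^ 2 / 2 + -y ^ 2 / 2) / (2 * Real.pi * Real.sqrt (1 - ρ ^ 2)) := by
    rw [phi, Real.exp_add]
    field_simp
  rw [h3, phiRho]
  gcongr
  rw [div_le_iff₀ (by linarith)]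
  nlinarith [sq_nonneg (x - ρ * y)]

theorem integrable_mul_phiRho {ρ : ℝ} (hρ : ρ ∈ Set.Ioo (-1 : ℝ) 1) {u v : ℝ → ℝ}
    (hu : Measurable u) (hv : Measurable v) {a b : ℝ} (hua : ∀ x, |u x| ≤ a)
    (hvb : ∀ x, |v x| ≤ b) :
    Integrable fun p : ℝ × ℝ => u p.1 * v p.2 * phiRho ρ p.1 p.2 := by
  refine (integrable_phiRho hρ).bdd_mul (c := a * b)
    ((hu.comp measurable_fst).mul (hv.comp measurable_snd)).aestronglyMeasurable
    (ae_of_all _ fun p => ?_)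
  rw [norm_mul]
  exact mul_le_mul (hua _) (hvb _) (abs_nonneg _) ((abs_nonneg _).trans (hua 0))

theorem integral_mul_phiRho_swap (ρ : ℝ) (u v : ℝ → ℝ) :
    ∫ p : ℝ × ℝ, u p.1 * v p.2 * phiRho ρ p.1 p.2 =
      ∫ p : ℝ × ℝ, v p.1 * u p.2 * phiRho ρ p.1 p.2 := by
  rw [Measure.volume_eq_prod, ← integral_prod_swap]
  congr 1 with p
  simp only [Prod.fst_swap, Prod.snd_swap]
  rw [phiRho_comm, mul_comm (u _)]

/-- The bilinear form with kernel `phiRho` is sequentially weakly continuous along bounded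
sequences. -/
theorem tendsto_integral_mul_phiRho {ρ : ℝ} (hρ : ρ ∈ Set.Ioo (-1 : ℝ) 1) {f : ℕ → ℝ → ℝ}
    {g : ℝ → ℝ} (hf : ∀ n, Measurable (f n)) (hf1 : ∀ n x, f n x ∈ Set.Icc (-1 : ℝ) 1)
    (hg : Measurable g) (hg1 : ∀ x, g x ∈ Set.Icc (-1 : ℝ) 1)
    (hfg : ∀ h : ℝ → ℝ, MemLp h 2 (gaussianReal 0 1) →
      Tendsto (fun n => ∫ x, f n x * h x ∂(gaussianReal 0 1)) atTop
        (𝓝 (∫ x, g x * h x ∂(gaussianReal 0 1)))) :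
    Tendsto (fun n => ∫ p : ℝ × ℝ, f n p.1 * f n p.2 * phiRho ρ p.1 p.2) atTop
      (𝓝 (∫ p : ℝ × ℝ, g p.1 * g p.2 * phiRho ρ p.1 p.2)) := by
  have hfa : ∀ n x, |f n x| ≤ 1 := fun n x => abs_le.2 (hf1 n x)
  have hga : ∀ x, |g x| ≤ 1 := fun x => abs_le.2 (hg1 x)
  have hadd : ∀ n x, |f n x + g x| ≤ 2 := fun n x =>
    (abs_add_le _ _).trans (by linarith [hfa n x, hga x])
  have hsub : ∀ n x, |f n x - g x| ≤ 2 := fun n x =>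
    (abs_sub _ _).trans (by linarith [hfa n x, hga x])
  have hK := integrable_phiRho hρ
  have hB : ∀ n, Integrable fun p : ℝ × ℝ =>
      (f n p.1 + g p.1) * (f n p.2 - g p.2) * phiRho ρ p.1 p.2 := fun n =>
    integrable_mul_phiRho hρ ((hf n).add hg) ((hf n).sub hg) (hadd n) (hsub n)
  have hdiff : ∀ n, ∫ p : ℝ × ℝ, f n p.1 * f n p.2 * phiRho ρ p.1 p.2 =
      (∫ x, (f n x + g x) * ∫ y, (f n y - g y) * phiRho ρ x y) +
        ∫ p : ℝ × ℝ, g p.1 * g p.2 * phiRho ρ p.1 p.2 := by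
    intro n
    have i1 := integrable_mul_phiRho hρ (hf n) (hf n) (hfa n) (hfa n)
    have i2 := integrable_mul_phiRho hρ (hf n) hg (hfa n) hga
    have i3 := integrable_mul_phiRho hρ hg (hf n) hga (hfa n)
    have i4 := integrable_mul_phiRho hρ hg hg hga hga
    have e1 : ∫ x, (f n x + g x) * ∫ y, (f n y - g y) * phiRho ρ x y =
        ∫ p : ℝ × ℝ, (f n p.1 + g p.1) * (f n p.2 - g p.2) * phiRho ρ p.1 p.2 := by
      rw [Measure.volume_eq_prod, integral_prod _ (hB n)]
      simp only [mul_assoc, integral_const_mul]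
    have e2 : ∫ p : ℝ × ℝ, (f n p.1 + g p.1) * (f n p.2 - g p.2) * phiRho ρ p.1 p.2 =
        ((∫ p : ℝ × ℝ, f n p.1 * f n p.2 * phiRho ρ p.1 p.2) -
          ∫ p : ℝ × ℝ, f n p.1 * g p.2 * phiRho ρ p.1 p.2) +
        ((∫ p : ℝ × ℝ, g p.1 * f n p.2 * phiRho ρ p.1 p.2) -
          ∫ p : ℝ × ℝ, g p.1 * g p.2 * phiRho ρ p.1 p.2) := by
      rw [← integral_sub i1 i2, ← integral_sub i3 i4]
      refine Eq.trans ?_ (integral_add (i1.sub i2) (i3.sub i4))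
      congr 1 with p
      ring
    rw [e1, e2, integral_mul_phiRho_swap ρ (f n) g]
    ring
  have hsec : ∀ x, Continuous fun y => phiRho ρ x y := fun x =>
    (continuous_phiRho ρ).comp (Continuous.prodMk_right x)
  have hphi : Continuous phi := by unfold phi; fun_prop
  have hsec_int : ∀ x, Integrable fun y => phiRho ρ x y := by
    intro x
    refine (integrable_phi.const_mul (Real.exp (x ^ 2 / 2) /
      (2 * Real.pi * Real.sqrt (1 - ρ ^ 2)) * Real.sqrt (2 * Real.pi))).mono'
      (hsec x).aestronglyMeasurable (ae_of_all _ fun y => ?_)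
    rw [Real.norm_of_nonneg (phiRho_nonneg _ _ _), ← div_le_iff₀ (phi_pos y)]
    exact phiRho_div_phi_le hρ x y
  have hpt : ∀ x, Tendsto (fun n => ∫ y, (f n y - g y) * phiRho ρ x y) atTop (𝓝 0) := by
    intro x
    have hm : MemLp (fun y => phiRho ρ x y / phi y) 2 (gaussianReal 0 1) := by
      refine MemLp.of_bound ((hsec x).div hphi fun y => (phi_pos y).ne').aestronglyMeasurable _
        (ae_of_all _ fun y => Eq.trans_le ?_ (phiRho_div_phi_le hρ x y))
      exact Real.norm_of_nonneg (div_nonneg (phiRho_nonneg _ _ _) (phi_pos y).le)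
    have key : ∀ u : ℝ → ℝ, ∫ y, u y * (phiRho ρ x y / phi y) ∂(gaussianReal 0 1) =
        ∫ y, u y * phiRho ρ x y := by
      intro u
      rw [integral_gaussianReal_eq_integral_mul_phi]
      congr 1 with y
      rw [mul_assoc, div_mul_cancel₀ _ (phi_pos y).ne']
    have h1 := hfg _ hm
    simp only [key] at h1
    have h2 : ∀ n, ∫ y, (f n y - g y) * phiRho ρ x y =
        (∫ y, f n y * phiRho ρ x y) - ∫ y, g y * phiRho ρ x y := by
      intro n
      simp only [sub_mul]
      exact integral_sub
        ((hsec_int x).bdd_mul (hf n).aestronglyMeasurable (ae_of_all _ (hfa n)))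
        ((hsec_int x).bdd_mul hg.aestronglyMeasurable (ae_of_all _ hga))
    simp only [h2]
    simpa using h1.sub_const (∫ y, g y * phiRho ρ x y)
  have hlim : Tendsto (fun n => ∫ x, (f n x + g x) * ∫ y, (f n y - g y) * phiRho ρ x y) atTop
      (𝓝 (∫ _ : ℝ, (0 : ℝ))) := by
    refine tendsto_integral_of_dominated_convergence
      (fun x => 2 * (2 * ∫ y, phiRho ρ x y)) ?_ ?_ ?_ ?_
    · intro n
      have := (hB n).integral_prod_left.aestronglyMeasurable
      simpa only [mul_assoc, integral_const_mul] using this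
    · rw [Measure.volume_eq_prod] at hK
      exact (hK.integral_prod_left.const_mul 2).const_mul 2
    · refine fun n => ae_of_all _ fun x => ?_
      rw [norm_mul]
      refine mul_le_mul (hadd n x) ?_ (norm_nonneg _) zero_le_two
      rw [← integral_const_mul]
      refine norm_integral_le_of_norm_le ((hsec_int x).const_mul 2) (ae_of_all _ fun y => ?_)
      rw [norm_mul, Real.norm_of_nonneg (phiRho_nonneg _ _ _)]
      exact mul_le_mul_of_nonneg_right (hsub n y) (phiRho_nonneg _ _ _)
    · refine ae_of_all _ fun x => squeeze_zero_norm (a := fun n =>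
        2 * ‖∫ y, (f n y - g y) * phiRho ρ x y‖) (fun n => ?_) ?_
      · rw [norm_mul]
        exact mul_le_mul_of_nonneg_right (hadd n x) (norm_nonneg _)
      · simpa using (hpt x).norm.const_mul 2
  simp only [hdiff]
  simpa using hlim.add_const (∫ p : ℝ × ℝ, g p.1 * g p.2 * phiRho ρ p.1 p.2)

/-- Existence of a minimizer: for `α ∈ (0,1)` and `ρ ∈ (−1,1)` there is a
measurable `f : ℝ → [−1,1]` with `L(f) ≤ L(g)` for every measurable
`g : ℝ → [−1,1]`. -/
theorem exists_minimizer_Lfun (α ρ : ℝ)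
    (hα : α ∈ Set.Ioo (0 : ℝ) 1) (hρ : ρ ∈ Set.Ioo (-1 : ℝ) 1) :
    ∃ f : ℝ → ℝ, Measurable f ∧ (∀ x, f x ∈ Set.Icc (-1 : ℝ) 1) ∧
      ∀ g : ℝ → ℝ, Measurable g → (∀ x, g x ∈ Set.Icc (-1 : ℝ) 1) →
        Lfun α ρ f ≤ Lfun α ρ g := by
  have hc : 0 ≤ (1 - α) / α := div_nonneg (by linarith [hα.2]) hα.1.le
  set S : Set ℝ := Lfun α ρ '' {f | Measurable f ∧ ∀ x, f x ∈ Set.Icc (-1 : ℝ) 1} with hS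
  have hne : S.Nonempty := ⟨_, 0, ⟨measurable_const, fun x => by simp⟩, rfl⟩
  have hbdd : BddBelow S := by
    refine ⟨-∫ p : ℝ × ℝ, phiRho ρ p.1 p.2, ?_⟩
    rintro _ ⟨f, ⟨-, hf1⟩, rfl⟩
    have h1 : 0 ≤ ∫ x, (f x) ^ 2 * phi x :=
      integral_nonneg fun x => mul_nonneg (sq_nonneg _) (phi_pos x).le
    have h2 : ‖∫ p : ℝ × ℝ, f p.1 * f p.2 * phiRho ρ p.1 p.2‖ ≤
        ∫ p : ℝ × ℝ, phiRho ρ p.1 p.2 := by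
      refine norm_integral_le_of_norm_le (integrable_phiRho hρ) (ae_of_all _ fun p => ?_)
      rw [norm_mul, norm_mul, Real.norm_of_nonneg (phiRho_nonneg _ _ _)]
      exact mul_le_of_le_one_left (phiRho_nonneg _ _ _)
        (mul_le_one₀ (abs_le.2 (hf1 _)) (norm_nonneg _) (abs_le.2 (hf1 _)))
    have h3 := neg_abs_le (∫ p : ℝ × ℝ, f p.1 * f p.2 * phiRho ρ p.1 p.2)
    rw [Real.norm_eq_abs] at h2
    have h4 := mul_nonneg hc h1
    unfold Lfun
    linarith
  obtain ⟨u, -, hu, huS⟩ := exists_seq_tendsto_sInf hne hbdd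
  choose f hf hfu using huS
  obtain ⟨g, hg, hg1, s, hs, hlim⟩ := exists_subseq_tendsto_integral_mul (gaussianReal 0 1) f
    (fun n => (hf n).1) (fun n => (hf n).2)
  refine ⟨g, hg, hg1, fun k hk hk1 => le_trans ?_ (csInf_le hbdd ⟨k, ⟨hk, hk1⟩, rfl⟩)⟩
  have hcross := tendsto_integral_mul_phiRho hρ (fun n => (hf (s n)).1) (fun n => (hf (s n)).2)
    hg hg1 hlim
  have hdiag := hlim g (MemLp.of_bound hg.aestronglyMeasurable 1
    (ae_of_all _ fun x => abs_le.2 (hg1 x)))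
  simp only [integral_gaussianReal_eq_integral_mul_phi] at hdiag
  have hlow := (((hdiag.const_mul 2).sub_const (∫ x, g x * g x * phi x)).const_mul
    ((1 - α) / α)).add hcross
  have hval : (1 - α) / α * (2 * (∫ x, g x * g x * phi x) - ∫ x, g x * g x * phi x) +
      ∫ p : ℝ × ℝ, g p.1 * g p.2 * phiRho ρ p.1 p.2 = Lfun α ρ g := by
    simp only [Lfun, pow_two]
    ring
  rw [hval] at hlow
  refine le_of_tendsto_of_tendsto' hlow (hu.comp hs.tendsto_atTop) fun n => ?_
  rw [Function.comp_apply, ← hfu, Lfun]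
  gcongr
  have hi : ∀ v w : ℝ → ℝ, Measurable v → Measurable w → (∀ x, v x ∈ Set.Icc (-1 : ℝ) 1) →
      (∀ x, w x ∈ Set.Icc (-1 : ℝ) 1) → Integrable fun x => v x * w x * phi x := by
    intro v w hv hw hv1 hw1
    refine integrable_phi.bdd_mul (c := 1) (hv.mul hw).aestronglyMeasurable
      (ae_of_all _ fun x => ?_)
    rw [norm_mul]
    exact mul_le_one₀ (abs_le.2 (hv1 _)) (norm_nonneg _) (abs_le.2 (hw1 _))
  obtain ⟨hm, hm1⟩ := hf (s n)
  have i1 := hi _ _ hm hg hm1 hg1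
  have i2 := hi _ _ hg hg hg1 hg1
  have i3 := hi _ _ hm hm hm1 hm1
  rw [← integral_const_mul, ← integral_sub (i1.const_mul 2) i2]
  simp only [pow_two]
  refine integral_mono ((i1.const_mul 2).sub i2) i3 fun x => ?_
  nlinarith [mul_nonneg (sq_nonneg (f (s n) x - g x)) (phi_pos x).le]
end

section
/- There exists a probability distribution on {−1,1}⁵, supported on points whose coordinates are not all equal (i.e., on satisfying assignments of the Not-All-Equal predicate NAE₅), whose coordinate random variables X₁, …, X₅ satisfy E[XᵢXⱼ] = 1/3 for all 1 ≤ i < j ≤ 4 and E[XᵢX₅] = 0 for all 1 ≤ i ≤ 4. (One such distribution puts probability 1/6 on each of the four points obtained from (1,1,1,1,1) by flipping exactly one of the first four coordinates, and probability 1/3 on (1,1,1,1,−1).) -/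
/-- The all-`true` assignment with coordinate `k` flipped. -/
def flipAt (k : Fin 5) : Fin 5 → Bool := Function.update (fun _ => true) k false

/-- The weights `1/6, 1/6, 1/6, 1/6, 1/3` of the five flipped points. -/
noncomputable def flipWeight (k : Fin 5) : ℝ := if k = 4 then 1 / 3 else 1 / 6

/-- The mixture of point masses at `flipAt k` with weights `flipWeight k`. -/
noncomputable def flipMass (s : Fin 5 → Bool) : ℝ :=
  ∑ k, if s = flipAt k then flipWeight k else 0

theorem sum_flipMass_mul (f : (Fin 5 → Bool) → ℝ) :
    ∑ s, flipMass s * f s = ∑ k, flipWeight k * f (flipAt k) := by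
  simp only [flipMass, Finset.sum_mul]
  rw [Finset.sum_comm]
  simp [ite_mul]

theorem flipWeight_nonneg (k : Fin 5) : 0 ≤ flipWeight k := by
  unfold flipWeight
  split_ifs <;> norm_num

theorem flipAt_not_all_equal (k : Fin 5) : ¬∀ i j, flipAt k i = flipAt k j := by
  revert k
  decide

/-- There is a probability distribution on `{−1,1}⁵`, supported on
assignments satisfying the Not-All-Equal predicate (coordinates not all
equal), whose pairwise biases are `E[XᵢXⱼ] = 1/3` for `1 ≤ i < j ≤ 4` and
`E[XᵢX₅] = 0` for `1 ≤ i ≤ 4`. -/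
theorem nae5_sdp_biases_realizable :
    ∃ p : (Fin 5 → Bool) → ℝ, (∀ s, 0 ≤ p s) ∧ (∑ s, p s) = 1 ∧
      (∀ s, p s ≠ 0 → ¬(∀ i j, s i = s j)) ∧
      (∀ i j : Fin 5, i < j → (j : ℕ) ≤ 3 →
        (∑ s, p s * (pm (s i) * pm (s j))) = 1 / 3) ∧
      (∀ i : Fin 5, (i : ℕ) ≤ 3 →
        (∑ s, p s * (pm (s i) * pm (s 4))) = 0) := by
  refine ⟨flipMass, fun s => ?_, ?_, fun s hs => ?_, fun i j hij hj => ?_, fun i hi => ?_⟩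
  · refine Finset.sum_nonneg fun k _ => ?_
    split_ifs
    exacts [flipWeight_nonneg k, le_rfl]
  · have h := sum_flipMass_mul fun _ => 1
    simp only [mul_one] at h
    rw [h]
    norm_num [Fin.sum_univ_five, flipWeight, Fin.ext_iff]
  · obtain ⟨k, -, hk⟩ := Finset.exists_ne_zero_of_sum_ne_zero hs
    obtain rfl : s = flipAt k := by
      by_contra h
      exact hk (if_neg h)
    exact flipAt_not_all_equal k
  · rw [sum_flipMass_mul fun s => pm (s i) * pm (s j)]
    fin_cases i <;> fin_cases j <;> first
      | (exfalso; revert hij hj; decide)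
      | norm_num [Fin.sum_univ_five, flipWeight, flipAt, pm, Function.update_apply, Fin.ext_iff]
  · rw [sum_flipMass_mul fun s => pm (s i) * pm (s 4)]
    fin_cases i <;> first
      | (exfalso; revert hi; decide)
      | norm_num [Fin.sum_univ_five, flipWeight, flipAt, pm, Function.update_apply, Fin.ext_iff]
end
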